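/- For every integer k ≥ 3 and all constants d > 0 and ε with 0 < ε < 1, there exists a constant c > 0 such that the following holds. Let n and ℓ be integers with 4 ≤ ℓ ≤ d·n^((1−ε)/2) and k < ℓ, and let P be a set of n points in the plane ℝ² with at most ℓ collinear. Then P contains a subset of at least c·(n^((k−1)/k) / ℓ^((k−2)/k))·(log n)^(1/k) points with at most k collinear. -/

import Mathlib

/-- A finite point set has "at most k collinear" if every collinear subset has ≤ k points. -/
def AtMostCollinear (P : Finset (ℝ × ℝ)) (k : ℕ) : Prop :=
  ∀ T ⊆ P, Collinear ℝ (T : Set (ℝ × ℝ)) → T.card ≤ k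

open Finset in
/-- A hypergraph with vertex set `V` and edges `f i`, `i ∈ E`, of sizes between `2` and `k + 1`,
in which two edges share at most one vertex and no three edges form a triangle. -/
structure SparseHypergraph {α ι : Type*} (k : ℕ) (V : Finset α) (E : Finset ι)
    (f : ι → Finset α) : Prop where
  subset : ∀ i ∈ E, f i ⊆ V
  two_le : ∀ i ∈ E, 2 ≤ #(f i)
  le_succ : ∀ i ∈ E, #(f i) ≤ k + 1
  linear : ∀ i ∈ E, ∀ j ∈ E, ∀ x ∈ f i, ∀ y ∈ f i, x ∈ f j → y ∈ f j → x ≠ y → i = j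
  triangle : ∀ i ∈ E, ∀ j ∈ E, ∀ j' ∈ E, ∀ v, v ∉ f i → ∀ u ∈ f i, ∀ u' ∈ f i,
    u ∈ f j → v ∈ f j → u' ∈ f j' → v ∈ f j' → u = u'

section Hypergraph

open Finset
open scoped Classical

variable {α ι : Type*} {k : ℕ} {V : Finset α} {E : Finset ι} {f : ι → Finset α}

/-- The weight `|e| z ^ (|e| - 1)` of the edge `e = f i`. -/
noncomputable def edgeWeight (f : ι → Finset α) (z : ℝ) (i : ι) : ℝ :=
  (#(f i) : ℝ) * z ^ (#(f i) - 1)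

/-- The number of vertices minus `lam` times the total weight of the edges. -/
noncomputable def potential (lam z : ℝ) (V : Finset α) (E : Finset ι) (f : ι → Finset α) : ℝ :=
  (#V : ℝ) - lam * ∑ i ∈ E, edgeWeight f z i

/-- The vertices joined to `v` by an edge of size two. -/
noncomputable def pairNeighbors (V : Finset α) (E : Finset ι) (f : ι → Finset α) (v : α) :
    Finset α :=
  V.filter fun u => u ≠ v ∧ ∃ j ∈ E, f j = {u, v}

/-- The vertices that remain available once `v` is put into the independent set. -/
noncomputable def linkVertices (V : Finset α) (E : Finset ι) (f : ι → Finset α) (v : α) :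
    Finset α :=
  V \ insert v (pairNeighbors V E f v)

/-- The edges that remain relevant once `v` is put into the independent set. -/
noncomputable def linkEdges (V : Finset α) (E : Finset ι) (f : ι → Finset α) (v : α) :
    Finset ι :=
  E.filter fun i => (f i).erase v ⊆ linkVertices V E f v

lemma edgeWeight_nonneg {z : ℝ} (hz : 0 ≤ z) (i : ι) : 0 ≤ edgeWeight f z i := by
  unfold edgeWeight; positivity

lemma mem_pairNeighbors {u v : α} :
    u ∈ pairNeighbors V E f v ↔ u ∈ V ∧ u ≠ v ∧ ∃ j ∈ E, f j = {u, v} := by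
  simp [pairNeighbors]

lemma mem_pairNeighbors_comm {u v : α} (hu : u ∈ V) (hv : v ∈ V) :
    u ∈ pairNeighbors V E f v ↔ v ∈ pairNeighbors V E f u := by
  rw [mem_pairNeighbors, mem_pairNeighbors]
  simp only [hu, hv, true_and, ne_comm, pair_comm]

lemma SparseHypergraph.link (h : SparseHypergraph k V E f) (v : α) :
    SparseHypergraph k (linkVertices V E f v) (linkEdges V E f v) fun i => (f i).erase v where
  subset _ hi := (mem_filter.1 hi).2
  two_le i hi := by
    obtain ⟨hiE, hs⟩ := mem_filter.1 hi
    have h2 := h.two_le i hiE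
    by_cases hv : v ∈ f i
    · rw [card_erase_of_mem hv]
      by_contra hlt
      have h2' : #(f i) = 2 := by omega
      have h1 : #((f i).erase v) = 1 := by rw [card_erase_of_mem hv]; omega
      obtain ⟨u, hu⟩ := card_eq_one.1 h1
      have hu' : u ∈ (f i).erase v := by simp [hu]
      have hfi : f i = {u, v} := by rw [← insert_erase hv, hu, pair_comm]
      have := hs hu'
      simp only [linkVertices, mem_sdiff, mem_insert, not_or, mem_pairNeighbors] at this
      exact this.2.2 ⟨this.1, this.2.1, i, hiE, hfi⟩
    · rwa [erase_eq_of_notMem hv]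
  le_succ i hi := (card_erase_le).trans (h.le_succ i (mem_filter.1 hi).1)
  linear i hi j hj x hx y hy hx' hy' hxy :=
    h.linear i (mem_filter.1 hi).1 j (mem_filter.1 hj).1 x (mem_of_mem_erase hx) y
      (mem_of_mem_erase hy) (mem_of_mem_erase hx') (mem_of_mem_erase hy') hxy
  triangle i hi j hj j' hj' w hw u hu u' hu' huj hwj hu'j hwj' :=
    h.triangle i (mem_filter.1 hi).1 j (mem_filter.1 hj).1 j' (mem_filter.1 hj').1 w
      (fun hwi => hw (mem_erase.2 ⟨ne_of_mem_erase hwj, hwi⟩)) u (mem_of_mem_erase hu) u'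
      (mem_of_mem_erase hu') (mem_of_mem_erase huj) (mem_of_mem_erase hwj)
      (mem_of_mem_erase hu'j) (mem_of_mem_erase hwj')

lemma SparseHypergraph.induce (h : SparseHypergraph k V E f) (W : Finset α) :
    SparseHypergraph k W (E.filter fun i => f i ⊆ W) f where
  subset _ hi := (mem_filter.1 hi).2
  two_le i hi := h.two_le i (mem_filter.1 hi).1
  le_succ i hi := h.le_succ i (mem_filter.1 hi).1
  linear i hi j hj := h.linear i (mem_filter.1 hi).1 j (mem_filter.1 hj).1
  triangle i hi j hj j' hj' :=
    h.triangle i (mem_filter.1 hi).1 j (mem_filter.1 hj).1 j' (mem_filter.1 hj').1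

/-- Every vertex meets edges of total weight at least `2 z` times its number of pair neighbors. -/
lemma two_mul_card_pairNeighbors_le {z : ℝ} (hz : 0 ≤ z) (u : α) :
    2 * z * #(pairNeighbors V E f u) ≤ ∑ i ∈ E with u ∈ f i, edgeWeight f z i := by
  have hex : ∀ v ∈ pairNeighbors V E f u, ∃ j ∈ E, f j = {v, u} := fun v hv =>
    (mem_pairNeighbors.1 hv).2.2
  obtain hemp | ⟨v₀, hv₀⟩ := (pairNeighbors V E f u).eq_empty_or_nonempty
  · rw [hemp, card_empty, Nat.cast_zero, mul_zero]
    exact sum_nonneg fun i _ => edgeWeight_nonneg hz i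
  have : Nonempty ι := ⟨(hex v₀ hv₀).choose⟩
  choose! g hgE hg using hex
  have hinj : Set.InjOn g (pairNeighbors V E f u : Set α) := by
    intro a ha b hb hab
    have h1 := hg a ha
    rw [hab, hg b hb] at h1
    have : a ∈ ({b, u} : Finset α) := by rw [h1]; simp
    rcases mem_insert.1 this with h | h
    · exact h
    · exact absurd (mem_singleton.1 h) (mem_pairNeighbors.1 ha).2.1
  calc 2 * z * #(pairNeighbors V E f u)
      = ∑ v ∈ pairNeighbors V E f u, edgeWeight f z (g v) := by
        rw [sum_congr rfl (g := fun _ => 2 * z), sum_const, nsmul_eq_mul, mul_comm]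
        intro v hv
        simp [edgeWeight, hg v hv, card_pair (mem_pairNeighbors.1 hv).2.1]
    _ = ∑ i ∈ (pairNeighbors V E f u).image g, edgeWeight f z i := (sum_image hinj).symm
    _ ≤ _ := by
        refine sum_le_sum_of_subset_of_nonneg ?_ fun i _ _ => edgeWeight_nonneg hz i
        intro i hi
        obtain ⟨v, hv, rfl⟩ := mem_image.1 hi
        simp [hgE v hv, hg v hv]

/-- Bernoulli's inequality read backwards. -/
lemma one_add_div_pow_le {θ : ℝ} (hθ : 0 ≤ θ) {j : ℕ} (hj : j ≤ k) :
    (1 + θ / (1 + k * θ)) ^ j ≤ 1 + j * θ := by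
  set δ := θ / (1 + k * θ) with hδ
  have hpos : 0 < 1 + k * θ := by positivity
  have hδ0 : 0 ≤ δ := by positivity
  have hθδ : θ = δ * (1 + k * θ) := by rw [hδ]; field_simp
  have hjk : (j : ℝ) ≤ k := by exact_mod_cast hj
  have hkδ : k * δ < 1 := by
    rw [hδ, ← mul_div_assoc, div_lt_one hpos]; linarith
  by_cases hk : k = 0
  · obtain rfl : j = 0 := by omega
    simp
  have hδ1 : δ ≤ 1 := by
    have : (1 : ℝ) ≤ k := by exact_mod_cast Nat.one_le_iff_ne_zero.2 hk
    nlinarith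
  have hb : 1 + (j : ℝ) * (-δ) ≤ (1 + -δ) ^ j := one_add_mul_le_pow (by linarith) j
  have hprod : (1 + δ) ^ j * (1 + -δ) ^ j ≤ 1 := by
    rw [← mul_pow]
    exact pow_le_one₀ (by nlinarith) (by nlinarith)
  have hjδ : 0 < 1 - j * δ := by nlinarith
  have h1 : (1 + δ) ^ j * (1 - j * δ) ≤ 1 := by
    refine le_trans ?_ hprod
    gcongr
    linarith
  have h2 : 1 ≤ (1 + j * θ) * (1 - j * δ) := by
    have : (1 + j * θ) * (1 - j * δ) = 1 + j * δ * ((k - j) * θ) := by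
      have : (j : ℝ) * θ = j * (δ * (1 + k * θ)) := by rw [← hθδ]
      linear_combination this
    rw [this]
    have : 0 ≤ j * δ * ((k - j) * θ) := by
      have : 0 ≤ (k : ℝ) - j := by linarith
      positivity
    linarith
  exact le_of_mul_le_mul_right (h1.trans h2) hjδ

end Hypergraph

section Hypergraph

open Finset
open scoped Classical

variable {α ι : Type*} {k : ℕ} {V : Finset α} {E : Finset ι} {f : ι → Finset α}

lemma card_linkVertices {v : α} (hv : v ∈ V) :
    (#(linkVertices V E f v) : ℝ) = #V - (1 + #(pairNeighbors V E f v)) := by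
  have hsub : insert v (pairNeighbors V E f v) ⊆ V :=
    insert_subset hv (filter_subset _ _)
  have hcard : #(insert v (pairNeighbors V E f v)) = #(pairNeighbors V E f v) + 1 :=
    card_insert_of_notMem fun h => (mem_pairNeighbors.1 h).2.1 rfl
  rw [linkVertices, cast_card_sdiff hsub, hcard]
  push_cast
  ring

/-- An upper bound for the weight of the edge `f i` after `v` has been selected. -/
noncomputable def linkWeightBound (z θ : ℝ) (V : Finset α) (E : Finset ι) (f : ι → Finset α)
    (v : α) (i : ι) : ℝ :=
  if v ∈ f i then (if #(f i) = 2 then 0 else 2 * ((#(f i) : ℝ) - 1) * z ^ (#(f i) - 2))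
  else edgeWeight f z i * (1 + θ * (#(f i) - 1) - #(f i ∩ pairNeighbors V E f v))

lemma SparseHypergraph.card_inter_pairNeighbors_le (h : SparseHypergraph k V E f) {i : ι}
    (hi : i ∈ E) {v : α} (hv : v ∉ f i) : #(f i ∩ pairNeighbors V E f v) ≤ 1 := by
  rw [card_le_one]
  intro u hu u' hu'
  obtain ⟨hui, hun⟩ := mem_inter.1 hu
  obtain ⟨hui', hun'⟩ := mem_inter.1 hu'
  obtain ⟨_, _, j, hj, hfj⟩ := mem_pairNeighbors.1 hun
  obtain ⟨_, _, j', hj', hfj'⟩ := mem_pairNeighbors.1 hun'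
  exact h.triangle i hi j hj j' hj' v hv u hui u' hui' (by simp [hfj]) (by simp [hfj])
    (by simp [hfj']) (by simp [hfj'])

lemma SparseHypergraph.sum_link_le (h : SparseHypergraph k V E f) {z z' θ : ℝ} (hz : 0 ≤ z)
    (hθ : 0 ≤ θ) (hkθ : k * θ ≤ 1)
    (hpow : ∀ j ≤ k, z' ^ j ≤ z ^ j * (1 + j * θ)) (v : α) :
    ∑ i ∈ linkEdges V E f v, edgeWeight (fun i => (f i).erase v) z' i ≤
      ∑ i ∈ E, linkWeightBound z θ V E f v i := by
  have hle : ∀ i ∈ linkEdges V E f v,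
      edgeWeight (fun i => (f i).erase v) z' i ≤ linkWeightBound z θ V E f v i := by
    intro i hi
    obtain ⟨hiE, hs⟩ := mem_filter.1 hi
    have h2 := (h.link v).two_le i hi
    have hk := h.le_succ i hiE
    unfold linkWeightBound edgeWeight
    by_cases hv : v ∈ f i
    · have hc : #((f i).erase v) = #(f i) - 1 := card_erase_of_mem hv
      have h3 : #(f i) ≠ 2 := by omega
      rw [if_pos hv, if_neg h3, hc, Nat.cast_sub (by omega), Nat.sub_sub, Nat.cast_one]
      have h1 : (0 : ℝ) ≤ #(f i) - 1 := by
        have : (1 : ℝ) ≤ #(f i) := by exact_mod_cast (by omega : 1 ≤ #(f i))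
        linarith
      have hp := hpow (#(f i) - 2) (by omega)
      have hjk : ((#(f i) - 2 : ℕ) : ℝ) ≤ k := by exact_mod_cast (by omega : #(f i) - 2 ≤ k)
      have hp2 : z' ^ (#(f i) - 2) ≤ 2 * z ^ (#(f i) - 2) := by
        refine hp.trans ?_
        rw [mul_comm]
        gcongr
        nlinarith
      calc ((#(f i) : ℝ) - 1) * z' ^ (#(f i) - 2)
          ≤ ((#(f i) : ℝ) - 1) * (2 * z ^ (#(f i) - 2)) := by gcongr
        _ = _ := by ring
    · rw [if_neg hv]
      simp only [erase_eq_of_notMem hv] at hs ⊢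
      have hempty : f i ∩ pairNeighbors V E f v = ∅ := by
        rw [← disjoint_iff_inter_eq_empty]
        refine disjoint_left.2 fun u hu hun => ?_
        have := hs hu
        simp only [linkVertices, mem_sdiff, mem_insert, not_or] at this
        exact this.2.2 hun
      have hp := hpow (#(f i) - 1) (by omega)
      rw [Nat.cast_sub (by have := h.two_le i hiE; omega), Nat.cast_one] at hp
      rw [hempty, card_empty, Nat.cast_zero, sub_zero, mul_assoc]
      gcongr
      linarith
  refine (sum_le_sum hle).trans (sum_le_sum_of_subset_of_nonneg (filter_subset _ _) ?_)
  intro i hi _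
  have h2 := h.two_le i hi
  have h1 : (0 : ℝ) ≤ #(f i) - 1 := by
    have : (1 : ℝ) ≤ #(f i) := by exact_mod_cast (by omega : 1 ≤ #(f i))
    linarith
  unfold linkWeightBound
  split_ifs with hv h3
  · exact le_rfl
  · positivity
  · refine mul_nonneg (edgeWeight_nonneg hz i) ?_
    have : (#(f i ∩ pairNeighbors V E f v) : ℝ) ≤ 1 := by
      exact_mod_cast h.card_inter_pairNeighbors_le hi hv
    have : 0 ≤ θ * ((#(f i) : ℝ) - 1) := by positivity
    linarith

lemma SparseHypergraph.sum_card_inter_pairNeighbors (h : SparseHypergraph k V E f) {i : ι}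
    (hi : i ∈ E) :
    ∑ u ∈ f i, #(pairNeighbors V E f u) ≤
      ∑ v ∈ V \ f i, #(f i ∩ pairNeighbors V E f v) + if #(f i) = 2 then 2 else 0 := by
  have hsub := h.subset i hi
  have hdouble : ∑ v ∈ V \ f i, #(f i ∩ pairNeighbors V E f v) =
      ∑ u ∈ f i, #(pairNeighbors V E f u \ f i) := by
    have e1 : ∀ v ∈ V \ f i, #(f i ∩ pairNeighbors V E f v) =
        ∑ u ∈ f i, if u ∈ pairNeighbors V E f v then 1 else 0 := fun v _ => by
      rw [← card_filter, filter_mem_eq_inter]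
    have e2 : ∀ u ∈ f i, #(pairNeighbors V E f u \ f i) =
        ∑ v ∈ V \ f i, if v ∈ pairNeighbors V E f u then 1 else 0 := fun u _ => by
      rw [← card_filter, filter_mem_eq_inter]
      congr 1
      ext w
      simp only [mem_sdiff, mem_inter]
      exact ⟨fun hw => ⟨⟨(mem_pairNeighbors.1 hw.1).1, hw.2⟩, hw.1⟩, fun hw => ⟨hw.2, hw.1.2⟩⟩
    rw [sum_congr rfl e1, sum_congr rfl e2, sum_comm]
    refine sum_congr rfl fun u hu => sum_congr rfl fun v hv => ?_
    simp only [mem_pairNeighbors_comm (hsub hu) (mem_sdiff.1 hv).1]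
  have hinter : ∑ u ∈ f i, #(pairNeighbors V E f u ∩ f i) ≤ if #(f i) = 2 then 2 else 0 := by
    have key : ∀ u ∈ f i, ∀ v ∈ pairNeighbors V E f u ∩ f i, f i = {v, u} := by
      intro u hu v hv
      obtain ⟨hvn, hvi⟩ := mem_inter.1 hv
      obtain ⟨_, hvu, j, hj, hfj⟩ := mem_pairNeighbors.1 hvn
      rw [h.linear i hi j hj u hu v hvi (by simp [hfj]) (by simp [hfj]) hvu.symm, hfj]
    split_ifs with h2
    · calc ∑ u ∈ f i, #(pairNeighbors V E f u ∩ f i) ≤ ∑ u ∈ f i, 1 := by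
            refine sum_le_sum fun u hu => card_le_one.2 fun a ha b hb => ?_
            have hab := key u hu a ha
            rw [key u hu b hb] at hab
            have : b ∈ ({a, u} : Finset α) := by rw [← hab]; simp
            rcases mem_insert.1 this with h | h
            · exact h.symm
            · exact absurd (mem_singleton.1 h)
                (mem_pairNeighbors.1 (mem_inter.1 hb).1).2.1
        _ = 2 := by simp [h2]
    · refine (sum_eq_zero fun u hu => ?_).le
      rw [card_eq_zero, eq_empty_iff_forall_notMem]
      intro v hv
      refine h2 ?_
      rw [key u hu v hv, card_pair (mem_pairNeighbors.1 (mem_inter.1 hv).1).2.1]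
  calc ∑ u ∈ f i, #(pairNeighbors V E f u)
      = ∑ u ∈ f i, #(pairNeighbors V E f u \ f i) + ∑ u ∈ f i, #(pairNeighbors V E f u ∩ f i) := by
        rw [← sum_add_distrib]
        exact sum_congr rfl fun u _ => (card_sdiff_add_card_inter _ _).symm
    _ ≤ _ := by rw [hdouble]; gcongr

lemma SparseHypergraph.sum_linkWeightBound_le (h : SparseHypergraph k V E f) {z θ : ℝ}
    (hz : 0 < z) (hz1 : z ≤ 1) (hθ : 0 ≤ θ) {i : ι} (hi : i ∈ E) :
    ∑ v ∈ V, linkWeightBound z θ V E f v i ≤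
      edgeWeight f z i * (#V + (#V * θ + 2 / z) * (#(f i) - 1)) -
        ∑ u ∈ f i, (1 + #(pairNeighbors V E f u) : ℝ) * edgeWeight f z i := by
  have h2 := h.two_le i hi
  have h2' : (2 : ℝ) ≤ #(f i) := by exact_mod_cast h2
  have hw := edgeWeight_nonneg (f := f) hz.le i
  have hsub := h.subset i hi
  set w := edgeWeight f z i with hwdef
  rw [← sum_sdiff hsub]
  have e1 : ∑ v ∈ V \ f i, linkWeightBound z θ V E f v i =
      (#V - #(f i)) * (w * (1 + θ * (#(f i) - 1))) -
        w * ∑ v ∈ V \ f i, (#(f i ∩ pairNeighbors V E f v) : ℝ) := by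
    rw [mul_sum, ← cast_card_sdiff hsub, ← nsmul_eq_mul, ← sum_const, ← sum_sub_distrib]
    refine sum_congr rfl fun v hv => ?_
    rw [linkWeightBound, if_neg (mem_sdiff.1 hv).2]
    ring
  have e2 : ∑ v ∈ f i, linkWeightBound z θ V E f v i + w * (if #(f i) = 2 then 2 else 0) ≤
      w * (2 / z * (#(f i) - 1)) := by
    rw [sum_congr rfl fun v hv => by rw [linkWeightBound, if_pos hv], sum_const, nsmul_eq_mul]
    split_ifs with h3
    · rw [h3, mul_zero, zero_add]
      gcongr
      rw [Nat.cast_ofNat, show (2 : ℝ) - 1 = 1 by norm_num, mul_one, le_div_iff₀ hz]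
      linarith
    · rw [mul_zero, add_zero, hwdef, edgeWeight]
      have : z ^ (#(f i) - 1) = z ^ (#(f i) - 2) * z := by
        rw [← pow_succ]; congr 1; omega
      rw [this]
      apply le_of_eq
      field_simp
  have e3 : (∑ u ∈ f i, (#(pairNeighbors V E f u) : ℝ)) ≤
      ∑ v ∈ V \ f i, (#(f i ∩ pairNeighbors V E f v) : ℝ) + if #(f i) = 2 then 2 else 0 := by
    have := h.sum_card_inter_pairNeighbors hi
    split_ifs at this ⊢ <;> exact_mod_cast this
  have e4 := mul_le_mul_of_nonneg_left e3 hw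
  rw [e1, ← sum_mul, sum_add_distrib, sum_const, nsmul_eq_mul, mul_one]
  have e5 : 0 ≤ (#(f i) : ℝ) * (w * (θ * (#(f i) - 1))) := by
    have : (0 : ℝ) ≤ #(f i) - 1 := by linarith
    positivity
  nlinarith [e4, e2, e5]

/-- Selecting a suitable vertex multiplies the potential by at least
`1 - (1 + K / z) / #V`, where `K = 1 / (2 * lam)`. -/
lemma SparseHypergraph.exists_potential_link_ge (h : SparseHypergraph k V E f)
    {lam K z z' θ : ℝ} (hlam : 0 < lam) (hK : 2 * lam * K = 1) (hV : V.Nonempty)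
    (hz : 0 < z) (hz1 : z ≤ 1) (hθ : 0 ≤ θ) (hkθ : k * θ ≤ 1)
    (hθV : #V * θ = (K - 2) / z)
    (hpow : ∀ j ≤ k, z' ^ j ≤ z ^ j * (1 + j * θ))
    (hdeg : ∀ u ∈ V, lam * ∑ i ∈ E with u ∈ f i, edgeWeight f z i ≤ 1) :
    ∃ v ∈ V, potential lam z V E f * (1 - (1 + K / z) / #V) ≤
      potential lam z' (linkVertices V E f v) (linkEdges V E f v) (fun i => (f i).erase v) := by
  have hN : (0 : ℝ) < #V := by exact_mod_cast hV.card_pos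
  refine exists_le_of_sum_le hV ?_
  rw [sum_const, nsmul_eq_mul]
  have hlow : ∀ v ∈ V, #V - (1 + #(pairNeighbors V E f v) : ℝ) -
      lam * ∑ i ∈ E, linkWeightBound z θ V E f v i ≤
      potential lam z' (linkVertices V E f v) (linkEdges V E f v) (fun i => (f i).erase v) := by
    intro v hv
    rw [potential, card_linkVertices hv]
    gcongr
    exact h.sum_link_le hz.le hθ hkθ hpow v
  refine le_trans ?_ (sum_le_sum hlow)
  set τ : α → ℝ := fun u => ∑ i ∈ E with u ∈ f i, edgeWeight f z i with hτ
  set n2 : α → ℝ := fun u => (#(pairNeighbors V E f u) : ℝ) with hn2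
  set W := ∑ i ∈ E, edgeWeight f z i with hW
  set Q := ∑ i ∈ E, edgeWeight f z i * ((#(f i) : ℝ) - 1) with hQ
  have hswap : ∀ g : α → ℝ, ∑ i ∈ E, ∑ u ∈ f i, g u * edgeWeight f z i = ∑ u ∈ V, g u * τ u := by
    intro g
    have : ∀ i ∈ E, ∑ u ∈ f i, g u * edgeWeight f z i =
        ∑ u ∈ V, if u ∈ f i then g u * edgeWeight f z i else 0 := fun i hi => by
      rw [← sum_filter, filter_mem_eq_inter, inter_eq_right.2 (h.subset i hi)]
    rw [sum_congr rfl this, sum_comm]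
    refine sum_congr rfl fun u _ => ?_
    rw [hτ, mul_sum, sum_filter]
  have hsumτ : ∑ u ∈ V, τ u = W + Q := by
    have := hswap fun _ => 1
    simp only [one_mul, sum_const, nsmul_eq_mul] at this
    rw [← this, hW, hQ, ← sum_add_distrib]
    exact sum_congr rfl fun i _ => by ring
  have hbound : ∑ v ∈ V, ∑ i ∈ E, linkWeightBound z θ V E f v i ≤
      #V * W + (#V * θ + 2 / z) * Q - ∑ u ∈ V, (1 + n2 u) * τ u := by
    rw [sum_comm, ← hswap, hW, hQ, mul_sum, mul_sum, ← sum_add_distrib, ← sum_sub_distrib]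
    refine sum_le_sum fun i hi => (h.sum_linkWeightBound_le hz hz1 hθ hi).trans (le_of_eq ?_)
    ring
  have hr : ∑ u ∈ V, (1 + n2 u) * (1 - lam * τ u) ≤ ∑ u ∈ V, (1 + K / z) * (1 - lam * τ u) := by
    refine sum_le_sum fun u hu => ?_
    have h1 : 0 ≤ 1 - lam * τ u := sub_nonneg.2 (hdeg u hu)
    have h2 : n2 u ≤ K / z := by
      rw [le_div_iff₀ hz]
      have h3 := two_mul_card_pairNeighbors_le (V := V) (E := E) (f := f) hz.le u
      have h4 : lam * (2 * z * n2 u) ≤ 1 :=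
        (mul_le_mul_of_nonneg_left h3 hlam.le).trans (hdeg u hu)
      have h5 : 2 * lam * (n2 u * z) ≤ 2 * lam * K := by rw [hK]; linarith
      exact le_of_mul_le_mul_left h5 (by positivity)
    gcongr
  rw [← mul_sum, sum_sub_distrib, sum_const, nsmul_eq_mul, mul_one, ← mul_sum, hsumτ] at hr
  have e1 : ∑ u ∈ V, (1 + n2 u) * (1 - lam * τ u) =
      ∑ u ∈ V, (1 + n2 u) - lam * ∑ u ∈ V, (1 + n2 u) * τ u := by
    rw [mul_sum, ← sum_sub_distrib]
    exact sum_congr rfl fun u _ => by ring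
  rw [e1] at hr
  rw [sum_sub_distrib, sum_sub_distrib, sum_const, nsmul_eq_mul, ← mul_sum]
  have e2 := mul_le_mul_of_nonneg_left hbound hlam.le
  have e3 : #V * (potential lam z V E f * (1 - (1 + K / z) / #V)) =
      (#V - lam * W) * (#V - (1 + K / z)) := by
    rw [potential, ← hW]; field_simp
  rw [e3]
  rw [hθV] at e2
  have e4 : (K - 2) / z + 2 / z = K / z := by ring
  rw [e4] at e2
  have hQ0 : 0 ≤ lam * Q := by
    refine mul_nonneg hlam.le (sum_nonneg fun i hi => mul_nonneg (edgeWeight_nonneg hz.le i) ?_)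
    have : (2 : ℝ) ≤ #(f i) := by exact_mod_cast h.two_le i hi
    linarith
  simp only [hn2] at *
  linarith

end Hypergraph

section Hypergraph

open Finset
open scoped Classical

variable {α ι : Type*} {k : ℕ} {V : Finset α} {E : Finset ι} {f : ι → Finset α}

lemma potential_le_card {lam z : ℝ} (hlam : 0 ≤ lam) (hz : 0 ≤ z) :
    potential lam z V E f ≤ #V := by
  have : 0 ≤ lam * ∑ i ∈ E, edgeWeight f z i :=
    mul_nonneg hlam (sum_nonneg fun i _ => edgeWeight_nonneg hz i)
  unfold potential
  linarith

/-- Passing to an induced subhypergraph of maximal potential bounds the weighted degrees. -/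
lemma SparseHypergraph.exists_induce (h : SparseHypergraph k V E f) (lam z : ℝ) :
    ∃ W ⊆ V, potential lam z V E f ≤ potential lam z W (E.filter fun i => f i ⊆ W) f ∧
      ∀ u ∈ W, lam * ∑ i ∈ (E.filter fun i => f i ⊆ W) with u ∈ f i, edgeWeight f z i ≤ 1 := by
  obtain ⟨W, hW, hmax⟩ := exists_max_image V.powerset
    (fun W => potential lam z W (E.filter fun i => f i ⊆ W) f) ⟨V, mem_powerset_self V⟩
  have hVW := hmax V (mem_powerset_self V)
  rw [filter_true_of_mem h.subset] at hVW
  refine ⟨W, mem_powerset.1 hW, hVW, fun u hu => ?_⟩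
  have hu' := hmax (W.erase u) (mem_powerset.2 ((erase_subset _ _).trans (mem_powerset.1 hW)))
  have hE : (E.filter fun i => f i ⊆ W.erase u) =
      (E.filter fun i => f i ⊆ W).filter fun i => u ∉ f i := by
    ext i
    simp only [mem_filter, subset_erase]
    tauto
  rw [hE] at hu'
  unfold potential at hu'
  rw [← sum_filter_add_sum_filter_not (E.filter fun i => f i ⊆ W) (fun i => u ∈ f i),
    cast_card_erase_of_mem hu] at hu'
  linarith

lemma potential_step_bound {κ K z N θ Ψ : ℝ} (hκ : 0 ≤ κ) (hK : 2 ≤ K) (hz : 0 < z) (hz1 : z ≤ 1)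
    (hΨ : 0 ≤ Ψ) (hΨN : Ψ ≤ N) (hN : 0 < N) (hθ : θ = (K - 2) / (z * N))
    (hB : (κ + 1) * (K + 1) ^ 2 ≤ z * N) :
    z * Ψ - 4 ≤ z * (1 + θ / (1 + κ * θ)) * (Ψ * (1 - (1 + K / z) / N)) := by
  set Y := z * N with hY
  have hYpos : 0 < Y := by positivity
  have hθ0 : 0 ≤ θ := by rw [hθ]; exact div_nonneg (by linarith) hYpos.le
  have hq : (1 + K / z) / N = (z + K) / Y := by rw [hY]; field_simp
  rw [hq]
  set q := (z + K) / Y with hqdef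
  have hq0 : 0 ≤ q := by positivity
  have hKY : K + 1 ≤ Y := by nlinarith [mul_nonneg hκ (sq_nonneg (K + 1))]
  have hq1 : q ≤ 1 := by rw [hqdef, div_le_one hYpos]; linarith
  have hδ : θ - κ * θ ^ 2 ≤ θ / (1 + κ * θ) := by
    rw [le_div_iff₀ (by positivity)]
    nlinarith [mul_nonneg (mul_nonneg hκ hκ) (pow_nonneg hθ0 3)]
  have hsmall : κ * θ ^ 2 + q * θ ≤ 1 / Y := by
    have h1 : κ * θ ^ 2 + q * θ = (κ * (K - 2) ^ 2 + (z + K) * (K - 2)) / Y ^ 2 := by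
      rw [hθ, hqdef]; field_simp
    rw [h1, div_le_div_iff₀ (by positivity) hYpos]
    have h2 : κ * (K - 2) ^ 2 ≤ κ * (K + 1) ^ 2 := by gcongr; linarith
    have h3 : κ * (K - 2) ^ 2 + (z + K) * (K - 2) ≤ Y := by nlinarith
    nlinarith
  have hdiff : θ - q = -(2 + z) / Y := by rw [hθ, hqdef]; ring
  have hdiff' : -(3 / Y) ≤ θ - q := by
    rw [hdiff, neg_div]
    gcongr
    linarith
  have hmain : 1 - 4 / Y ≤ (1 + θ / (1 + κ * θ)) * (1 - q) := by
    have h1 : (1 + (θ - κ * θ ^ 2)) * (1 - q) ≤ (1 + θ / (1 + κ * θ)) * (1 - q) := by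
      have : 0 ≤ 1 - q := by linarith
      gcongr
    refine le_trans ?_ h1
    have h4 : 4 / Y = 3 / Y + 1 / Y := by ring
    nlinarith [mul_nonneg (mul_nonneg hκ (sq_nonneg θ)) hq0]
  calc z * Ψ - 4 ≤ z * Ψ * (1 - 4 / Y) := by
        have : z * Ψ * (4 / Y) ≤ 4 := by
          rw [mul_div_assoc', div_le_iff₀ hYpos]
          have : z * Ψ ≤ Y := by rw [hY]; gcongr
          linarith
        linarith
    _ ≤ z * Ψ * ((1 + θ / (1 + κ * θ)) * (1 - q)) := by gcongr
    _ = _ := by ring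

/-- A sparse hypergraph of large potential contains a large independent set. -/
theorem SparseHypergraph.exists_independent {lam K B : ℝ} (hlam : 0 < lam)
    (hK : 2 * lam * K = 1) (hK2 : 2 ≤ K) (hB : (k + 1) * (K + 1) ^ 2 ≤ B) (m : ℕ) {z : ℝ}
    (h : SparseHypergraph k V E f) (hz : 0 < z) (hzm : z * (1 + K / B) ^ m ≤ 1)
    (hpot : B + 4 * m ≤ z * potential lam z V E f) :
    ∃ S ⊆ V, m ≤ #S ∧ ∀ i ∈ E, ¬ f i ⊆ S := by
  have hBpos : 0 < B := lt_of_lt_of_le (by positivity) hB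
  induction m generalizing V E f z with
  | zero =>
    refine ⟨∅, empty_subset _, le_rfl, fun i hi hs => ?_⟩
    have := h.two_le i hi
    rw [subset_empty.1 hs] at this
    simp at this
  | succ m ih =>
    obtain ⟨W, hWV, hpotW, hdeg⟩ := h.exists_induce lam z
    set F := E.filter fun i => f i ⊆ W with hF
    have hW : SparseHypergraph k W F f := h.induce W
    set Ψ := potential lam z W F f with hΨ
    have hzΨ : B + 4 * ((m + 1 : ℕ) : ℝ) ≤ z * Ψ := hpot.trans (by gcongr)
    have hm : (0 : ℝ) ≤ 4 * ((m + 1 : ℕ) : ℝ) := by positivity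
    have hΨpos : 0 < Ψ := pos_of_mul_pos_right (hBpos.trans_le (by linarith)) hz.le
    have hΨN : Ψ ≤ #W := potential_le_card hlam.le hz.le
    have hN : (0 : ℝ) < #W := hΨpos.trans_le hΨN
    have hWne : W.Nonempty := card_pos.1 (by exact_mod_cast hN)
    have hzN : B ≤ z * #W := by
      have : z * Ψ ≤ z * #W := by gcongr
      linarith
    have hKB : 1 ≤ 1 + K / B := by
      have : 0 ≤ K / B := by positivity
      linarith
    have hz1 : z ≤ 1 := le_trans (le_mul_of_one_le_right hz.le (one_le_pow₀ hKB)) hzm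
    obtain ⟨θ, hθ⟩ : ∃ θ, θ = (K - 2) / (z * #W) := ⟨_, rfl⟩
    have hθ0 : 0 ≤ θ := by rw [hθ]; exact div_nonneg (by linarith) (by positivity)
    have hkθ : k * θ ≤ 1 := by
      rw [hθ, mul_div_assoc', div_le_one (by positivity)]
      have : (k : ℝ) * (K - 2) ≤ (k + 1) * (K + 1) ^ 2 := by
        gcongr
        · linarith
        · nlinarith
      linarith
    obtain ⟨v, hvW, hv⟩ := hW.exists_potential_link_ge (z' := z * (1 + θ / (1 + k * θ))) hlam hK
      hWne hz hz1 hθ0 hkθ (by rw [hθ]; field_simp)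
      (fun j hj => by rw [mul_pow]; gcongr; exact one_add_div_pow_le hθ0 hj) hdeg
    have hz'pos : 0 < z * (1 + θ / (1 + k * θ)) := by positivity
    have hθB : θ / (1 + k * θ) ≤ K / B := by
      calc θ / (1 + k * θ) ≤ θ :=
            div_le_self hθ0 (by linarith [mul_nonneg (Nat.cast_nonneg (α := ℝ) k) hθ0])
        _ ≤ K / B := by
            rw [hθ]
            gcongr
            linarith
    obtain ⟨S, hS, hcard, hind⟩ := ih (hW.link v) hz'pos
      (by
        refine le_trans ?_ hzm
        rw [pow_succ', ← mul_assoc]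
        gcongr)
      (by
        have h1 := potential_step_bound (Nat.cast_nonneg k) hK2 hz hz1 hΨpos.le hΨN hN hθ
          (hB.trans hzN)
        have h2 := h1.trans (mul_le_mul_of_nonneg_left hv hz'pos.le)
        refine le_trans ?_ h2
        push_cast at hzΨ
        linarith)
    have hvS : v ∉ S := fun hvS => by
      have := hS hvS
      simp [linkVertices] at this
    have hSW : S ⊆ W := hS.trans sdiff_subset
    refine ⟨insert v S, insert_subset (hWV hvW) (hSW.trans hWV), ?_, fun i hi hs => ?_⟩
    · rw [card_insert_of_notMem hvS]
      omega
    · have hs' : (f i).erase v ⊆ S := subset_insert_iff.1 hs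
      have hiF : i ∈ F := mem_filter.2 ⟨hi, hs.trans (insert_subset hvW hSW)⟩
      exact hind i (mem_filter.2 ⟨hiF, hs'.trans hS⟩) hs'

end Hypergraph

section Sampling

open Finset
open scoped Classical

variable {α ι : Type*} {p : ℝ} {V : Finset α}

/-- The expectation of `F S` when `S` contains each point of `V` independently with
probability `p`. -/
noncomputable def samplingMean (p : ℝ) (V : Finset α) (F : Finset α → ℝ) : ℝ :=
  ∑ S ∈ V.powerset, p ^ #S * (1 - p) ^ (#V - #S) * F S

theorem samplingMean_sub (F G : Finset α → ℝ) :
    samplingMean p V (fun S => F S - G S) = samplingMean p V F - samplingMean p V G := by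
  simp only [samplingMean, mul_sub, sum_sub_distrib]

theorem samplingMean_const_mul (c : ℝ) (F : Finset α → ℝ) :
    samplingMean p V (fun S => c * F S) = c * samplingMean p V F := by
  simp only [samplingMean, mul_sum]
  exact sum_congr rfl fun S _ => by ring

theorem exists_samplingMean_le (hp0 : 0 ≤ p) (hp1 : p ≤ 1) (F : Finset α → ℝ) :
    ∃ S ⊆ V, samplingMean p V F ≤ F S := by
  obtain ⟨S, hS, hmax⟩ := exists_max_image V.powerset F ⟨V, mem_powerset_self V⟩
  refine ⟨S, mem_powerset.1 hS, ?_⟩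
  have htotal : ∑ T ∈ V.powerset, p ^ #T * (1 - p) ^ (#V - #T) = 1 := by
    rw [sum_pow_mul_eq_add_pow]; simp
  calc samplingMean p V F ≤ ∑ T ∈ V.powerset, p ^ #T * (1 - p) ^ (#V - #T) * F S :=
        sum_le_sum fun T hT => mul_le_mul_of_nonneg_left (hmax T hT)
          (mul_nonneg (pow_nonneg hp0 _) (pow_nonneg (sub_nonneg.2 hp1) _))
    _ = F S := by rw [← sum_mul, htotal, one_mul]

theorem samplingMean_superset [DecidableEq α] {A : Finset α} (hA : A ⊆ V) :
    samplingMean p V (fun S => if A ⊆ S then 1 else 0) = p ^ #A := by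
  have h := prod_add (fun _ => p) (fun v => if v ∈ A then 0 else 1 - p) V
  have hl : ∏ v ∈ V, (p + if v ∈ A then 0 else 1 - p) = p ^ #A := by
    rw [← prod_const, ← prod_subset hA (f := fun v => p + if v ∈ A then 0 else 1 - p)
      (fun v _ hv => by simp [hv])]
    exact prod_congr rfl fun v hv => by simp [hv]
  rw [← hl, h, samplingMean]
  refine sum_congr rfl fun S hS => ?_
  have hSV := mem_powerset.1 hS
  rw [prod_const, mul_assoc]
  congr 1
  split_ifs with hAS
  · rw [mul_one, ← card_sdiff_of_subset hSV, ← prod_const]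
    refine prod_congr rfl fun v hv => ?_
    rw [if_neg fun hvA => (mem_sdiff.1 hv).2 (hAS hvA)]
  · obtain ⟨v, hvA, hvS⟩ := not_subset.1 hAS
    rw [mul_zero, prod_eq_zero (mem_sdiff.2 ⟨hA hvA, hvS⟩) (by simp [hvA])]

theorem samplingMean_card_filter [DecidableEq α] {C : Finset ι} {A : ι → Finset α}
    (hA : ∀ c ∈ C, A c ⊆ V) :
    samplingMean p V (fun S => (#(C.filter fun c => A c ⊆ S) : ℝ)) = ∑ c ∈ C, p ^ #(A c) := by
  rw [sum_congr rfl fun c hc => (samplingMean_superset (p := p) (hA c hc)).symm]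
  simp only [samplingMean]
  rw [sum_comm]
  refine sum_congr rfl fun S _ => ?_
  rw [← mul_sum, sum_boole]

theorem samplingMean_card : samplingMean p V (fun S => (#S : ℝ)) = p * #V := by
  have h := samplingMean_card_filter (p := p) (V := V) (C := V) (A := fun v => {v})
    (by simp)
  simp only [card_singleton, pow_one, sum_const, nsmul_eq_mul] at h
  rw [mul_comm, ← h]
  refine sum_congr rfl fun S hS => ?_
  congr 3
  ext v
  simpa using fun hv => mem_powerset.1 hS hv

end Sampling

section PlaneGraph

open Finset Filter Topology
open scoped Classical

/-- The slope of the segment with end points `e.1` and `e.2`. -/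
noncomputable def segSlope (e : (ℝ × ℝ) × (ℝ × ℝ)) : ℝ := (e.2.2 - e.1.2) / (e.2.1 - e.1.1)

/-- The ordinate over `t` of the line through the points `e.1` and `e.2`. -/
noncomputable def segHeight (e : (ℝ × ℝ) × (ℝ × ℝ)) (t : ℝ) : ℝ :=
  e.1.2 + segSlope e * (t - e.1.1)

theorem segHeight_left (e : (ℝ × ℝ) × (ℝ × ℝ)) : segHeight e e.1.1 = e.1.2 := by
  simp [segHeight]

theorem segHeight_right {e : (ℝ × ℝ) × (ℝ × ℝ)} (he : e.1.1 < e.2.1) :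
    segHeight e e.2.1 = e.2.2 := by
  have : e.2.1 - e.1.1 ≠ 0 := (sub_pos.2 he).ne'
  simp [segHeight, segSlope, this]

theorem continuous_segHeight (e : (ℝ × ℝ) × (ℝ × ℝ)) : Continuous (segHeight e) := by
  unfold segHeight; fun_prop

theorem segHeight_lt_of_slope_lt {e f : (ℝ × ℝ) × (ℝ × ℝ)} {t : ℝ} (h : f.1 = e.1)
    (hs : segSlope e < segSlope f) (ht : e.1.1 < t) : segHeight e t < segHeight f t := by
  simp only [segHeight, h]
  have := mul_lt_mul_of_pos_right hs (sub_pos.2 ht)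
  linarith

/-- A straight line drawing without crossings: no edge contains a vertex in its interior and
the interiors of distinct edges are disjoint. No edge is vertical, and edges are oriented from left
to right. -/
structure IsPlaneGraph (V : Finset (ℝ × ℝ)) (G : Finset ((ℝ × ℝ) × (ℝ × ℝ))) : Prop where
  left_mem : ∀ e ∈ G, e.1 ∈ V
  right_mem : ∀ e ∈ G, e.2 ∈ V
  lt : ∀ e ∈ G, e.1.1 < e.2.1
  vertex : ∀ e ∈ G, ∀ w ∈ V, e.1.1 < w.1 → w.1 < e.2.1 → segHeight e w.1 ≠ w.2
  crossing : ∀ e ∈ G, ∀ f ∈ G, ∀ t, e.1.1 < t → t < e.2.1 → f.1.1 < t → t < f.2.1 →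
    segHeight e t = segHeight f t → e = f

/-- `f` is the edge following `e` in the counterclockwise order of the edges going to the right from
the left end point of `e`. -/
def IsNextEdge (G : Finset ((ℝ × ℝ) × (ℝ × ℝ))) (e f : (ℝ × ℝ) × (ℝ × ℝ)) : Prop :=
  f ∈ G ∧ f.1 = e.1 ∧ segSlope e < segSlope f ∧
    ∀ g ∈ G, g.1 = e.1 → segSlope e < segSlope g → segSlope f ≤ segSlope g

/-- The vertices in the wedge between `e` and `f`, as far as both edges reach. -/
noncomputable def wedge (V : Finset (ℝ × ℝ)) (e f : (ℝ × ℝ) × (ℝ × ℝ)) : Finset (ℝ × ℝ) :=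
  V.filter fun w => e.1.1 < w.1 ∧ w.1 ≤ e.2.1 ∧ w.1 ≤ f.2.1 ∧
    segHeight e w.1 ≤ w.2 ∧ w.2 ≤ segHeight f w.1

/-- `x` is a leftmost vertex in the wedge between `e` and `f`. -/
def IsWedgeVertex (V : Finset (ℝ × ℝ)) (e f : (ℝ × ℝ) × (ℝ × ℝ)) (x : ℝ × ℝ) : Prop :=
  x ∈ wedge V e f ∧ ∀ w ∈ wedge V e f, x.1 ≤ w.1

variable {V : Finset (ℝ × ℝ)} {G : Finset ((ℝ × ℝ) × (ℝ × ℝ))}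

namespace IsPlaneGraph

theorem height_le (h : IsPlaneGraph V G) {e f : (ℝ × ℝ) × (ℝ × ℝ)} (he : e ∈ G) (hf : f ∈ G)
    {s t : ℝ} (hse : s ∈ Set.Icc e.1.1 e.2.1) (hsf : s ∈ Set.Icc f.1.1 f.2.1)
    (hte : t ∈ Set.Icc e.1.1 e.2.1) (htf : t ∈ Set.Icc f.1.1 f.2.1)
    (hs : segHeight e s < segHeight f s) : segHeight e t ≤ segHeight f t := by
  by_contra! ht
  have hc : Continuous fun r => segHeight f r - segHeight e r :=
    (continuous_segHeight f).sub (continuous_segHeight e)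
  have key : ∃ r, min s t < r ∧ r < max s t ∧ segHeight e r = segHeight f r := by
    rcases lt_trichotomy s t with hst | hst | hst
    · obtain ⟨r, hr, hr0⟩ := intermediate_value_Ioo' hst.le hc.continuousOn
        (show (0 : ℝ) ∈ Set.Ioo _ _ from ⟨sub_neg.2 ht, sub_pos.2 hs⟩)
      exact ⟨r, by rw [min_eq_left hst.le]; exact hr.1, by rw [max_eq_right hst.le]; exact hr.2,
        by dsimp only at hr0; linarith⟩
    · subst hst; exact absurd ht hs.not_gt
    · obtain ⟨r, hr, hr0⟩ := intermediate_value_Ioo hst.le hc.continuousOn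
        (show (0 : ℝ) ∈ Set.Ioo _ _ from ⟨sub_neg.2 ht, sub_pos.2 hs⟩)
      exact ⟨r, by rw [min_eq_right hst.le]; exact hr.1, by rw [max_eq_left hst.le]; exact hr.2,
        by dsimp only at hr0; linarith⟩
  obtain ⟨r, hr1, hr2, hr⟩ := key
  have hef := h.crossing e he f hf r ((le_min hse.1 hte.1).trans_lt hr1)
    (hr2.trans_le (max_le hse.2 hte.2)) ((le_min hsf.1 htf.1).trans_lt hr1)
    (hr2.trans_le (max_le hsf.2 htf.2)) hr
  rw [hef] at hs
  exact lt_irrefl _ hs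

theorem eq_of_slope_eq (h : IsPlaneGraph V G) {e f : (ℝ × ℝ) × (ℝ × ℝ)} (he : e ∈ G) (hf : f ∈ G)
    (h1 : e.1 = f.1) (hs : segSlope e = segSlope f) : e = f := by
  have hle := h.lt e he
  have hlf := h.lt f hf
  obtain ⟨t, ht1, ht2⟩ := exists_between (lt_min hle (h1 ▸ hlf : e.1.1 < f.2.1))
  exact h.crossing e he f hf t ht1 (ht2.trans_le (min_le_left _ _)) (h1 ▸ ht1)
    (ht2.trans_le (min_le_right _ _)) (by simp only [segHeight, h1, hs])

theorem eq_of_isNextEdge (h : IsPlaneGraph V G) {e f g : (ℝ × ℝ) × (ℝ × ℝ)} (he : e ∈ G)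
    (hf : f ∈ G) (heg : IsNextEdge G e g) (hfg : IsNextEdge G f g) : e = f := by
  obtain ⟨-, h1, h2, h3⟩ := heg
  obtain ⟨-, h1', h2', h3'⟩ := hfg
  have hef : e.1 = f.1 := h1.symm.trans h1'
  rcases lt_trichotomy (segSlope e) (segSlope f) with hlt | heq | hlt
  · exact absurd (h3 f hf hef.symm hlt) h2'.not_ge
  · exact h.eq_of_slope_eq he hf hef heq
  · exact absurd (h3' e he hef hlt) h2.not_ge

theorem exists_isWedgeVertex (h : IsPlaneGraph V G) {e f : (ℝ × ℝ) × (ℝ × ℝ)} (he : e ∈ G)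
    (hef : IsNextEdge G e f) : ∃ x, IsWedgeVertex V e f x := by
  obtain ⟨hf, h1, h2, -⟩ := hef
  have hle := h.lt e he
  have hlf := h.lt f hf
  have hne : (wedge V e f).Nonempty := by
    rcases le_total e.2.1 f.2.1 with hle' | hle'
    · refine ⟨e.2, mem_filter.2 ⟨h.right_mem e he, hle, le_rfl, hle', ?_, ?_⟩⟩
      · rw [segHeight_right hle]
      · rw [← segHeight_right hle]
        exact (segHeight_lt_of_slope_lt h1 h2 hle).le
    · have hlf' : e.1.1 < f.2.1 := h1 ▸ hlf
      refine ⟨f.2, mem_filter.2 ⟨h.right_mem f hf, hlf', hle', le_rfl, ?_, ?_⟩⟩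
      · rw [← segHeight_right hlf]
        exact (segHeight_lt_of_slope_lt h1 h2 hlf').le
      · rw [segHeight_right hlf]
  obtain ⟨x, hx, hmin⟩ := exists_min_image _ Prod.fst hne
  exact ⟨x, hx, hmin⟩

/-- To the left of a leftmost vertex of the wedge between `e` and `f`, no further edge enters
the wedge. -/
theorem eq_or_eq_of_mem_wedge (h : IsPlaneGraph V G) {e f g : (ℝ × ℝ) × (ℝ × ℝ)} {x : ℝ × ℝ}
    (he : e ∈ G) (hef : IsNextEdge G e f) (hx : IsWedgeVertex V e f x) (hg : g ∈ G) {t : ℝ}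
    (het : e.1.1 < t) (hgt : g.1.1 < t) (htx : t < x.1) (htg : t ≤ g.2.1)
    (h1 : segHeight e t ≤ segHeight g t) (h2 : segHeight g t ≤ segHeight f t) :
    g = e ∨ g = f := by
  by_contra! hne
  obtain ⟨hf, hfe, hslope, hnext⟩ := hef
  obtain ⟨hxw, hmin⟩ := hx
  simp only [wedge, mem_filter] at hxw hmin
  obtain ⟨hxV, hxe, hxe', hxf, hxh, hxh'⟩ := hxw
  have hlg := h.lt g hg
  have hfe1 : f.1.1 = e.1.1 := by rw [hfe]
  have htg' : t < g.2.1 := by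
    refine lt_of_le_of_ne htg fun htg' => ?_
    have hh := segHeight_right hlg
    rw [← htg'] at hh
    have := hmin g.2 ⟨h.right_mem g hg, htg' ▸ het, by linarith, by linarith,
      by rw [← htg', ← hh]; exact h1, by rw [← htg', ← hh]; exact h2⟩
    linarith
  have h1' : segHeight e t < segHeight g t := h1.lt_of_ne fun heq =>
    hne.1 (h.crossing e he g hg t het (by linarith) hgt htg' heq).symm
  have h2' : segHeight g t < segHeight f t := h2.lt_of_ne fun heq =>
    hne.2 (h.crossing g hg f hf t hgt htg' (by linarith) (by linarith) heq)
  have hbelow : ∀ s, e.1.1 ≤ s → g.1.1 ≤ s → s ≤ t →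
      segHeight e s ≤ segHeight g s ∧ segHeight g s ≤ segHeight f s := fun s hs hs' hst =>
    ⟨h.height_le he hg ⟨het.le, by linarith⟩ ⟨hgt.le, htg⟩ ⟨hs, by linarith⟩
      ⟨hs', by linarith⟩ h1',
    h.height_le hg hf ⟨hgt.le, htg⟩ ⟨by linarith, by linarith⟩ ⟨hs', by linarith⟩
      ⟨by linarith, by linarith⟩ h2'⟩
  have hfu : segHeight f e.1.1 = e.1.2 := by rw [← hfe]; exact segHeight_left f
  rcases lt_trichotomy g.1.1 e.1.1 with hlt | heq | hlt
  · have hb := hbelow e.1.1 le_rfl hlt.le het.le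
    rw [segHeight_left, hfu] at hb
    exact h.vertex g hg e.1 (h.left_mem e he) hlt (by linarith) (le_antisymm hb.2 hb.1)
  · have hb := hbelow e.1.1 le_rfl heq.le het.le
    rw [segHeight_left, hfu, ← heq, segHeight_left] at hb
    have hge : g.1 = e.1 := Prod.ext heq (le_antisymm hb.2 hb.1)
    have hs : segSlope e < segSlope g := by
      simp only [segHeight, hge] at h1'
      exact lt_of_mul_lt_mul_right (by linarith) (sub_pos.2 het).le
    have hs' : segSlope g < segSlope f := by
      simp only [segHeight, hge, hfe] at h2'
      exact lt_of_mul_lt_mul_right (by linarith) (sub_pos.2 het).le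
    exact absurd (hnext g hg hge hs) hs'.not_ge
  · have hb := hbelow g.1.1 hlt.le le_rfl hgt.le
    rw [segHeight_left] at hb
    have := hmin g.1 ⟨h.left_mem g hg, hlt, by linarith, by linarith, hb.1, hb.2⟩
    linarith

theorem eq_of_isWedgeVertex_of_lt (h : IsPlaneGraph V G) {e e' f f' : (ℝ × ℝ) × (ℝ × ℝ)}
    {x : ℝ × ℝ} (he : e ∈ G) (hf : f ∈ G) (hee : IsNextEdge G e e') (hff : IsNextEdge G f f')
    (hxe : IsWedgeVertex V e e' x) (hxf : IsWedgeVertex V f f' x)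
    (hlte : x.2 < segHeight e' x.1) (hltf : x.2 < segHeight f' x.1) : e = f := by
  obtain ⟨-, he1, he2, -, he3, -⟩ := mem_filter.1 hxe.1
  obtain ⟨-, hf1, hf2, -, hf3, -⟩ := mem_filter.1 hxf.1
  have hev : ∀ᶠ t in 𝓝[<] x.1, segHeight f t < segHeight e' t ∧ segHeight e t < segHeight f' t ∧
      e.1.1 < t ∧ f.1.1 < t ∧ t < x.1 := by
    filter_upwards [nhdsWithin_le_nhds ((continuous_segHeight f).continuousAt.eventually_lt
      (continuous_segHeight e').continuousAt (hf3.trans_lt hlte)),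
      nhdsWithin_le_nhds ((continuous_segHeight e).continuousAt.eventually_lt
      (continuous_segHeight f').continuousAt (he3.trans_lt hltf)),
      nhdsWithin_le_nhds (lt_mem_nhds he1), nhdsWithin_le_nhds (lt_mem_nhds hf1),
      self_mem_nhdsWithin] with t h1 h2 h3 h4 h5 using ⟨h1, h2, h3, h4, h5⟩
  obtain ⟨t, h1, h2, h3, h4, h5⟩ := hev.exists
  rcases le_total (segHeight e t) (segHeight f t) with hle | hle
  · rcases h.eq_or_eq_of_mem_wedge he hee hxe hf h3 h4 h5 (h5.le.trans hf2) hle h1.le with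
      heq | heq
    · exact heq.symm
    · exact absurd h1 (by rw [heq]; exact lt_irrefl _)
  · rcases h.eq_or_eq_of_mem_wedge hf hff hxf he h4 h3 h5 (h5.le.trans he2) hle h2.le with
      heq | heq
    · exact heq
    · exact absurd h2 (by rw [heq]; exact lt_irrefl _)

theorem eq_of_isWedgeVertex_of_eq (h : IsPlaneGraph V G) {e e' f f' : (ℝ × ℝ) × (ℝ × ℝ)}
    {x : ℝ × ℝ} (he : e ∈ G) (hf : f ∈ G) (hee : IsNextEdge G e e') (hff : IsNextEdge G f f')
    (hxe : IsWedgeVertex V e e' x) (hxf : IsWedgeVertex V f f' x)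
    (heqe : x.2 = segHeight e' x.1) (heqf : x.2 = segHeight f' x.1) : e = f := by
  obtain ⟨-, he1, -, he2, -, -⟩ := mem_filter.1 hxe.1
  obtain ⟨-, hf1, -, hf2, -, -⟩ := mem_filter.1 hxf.1
  have hlte : segHeight e x.1 < segHeight f' x.1 := by
    rw [← heqf, heqe]; exact segHeight_lt_of_slope_lt hee.2.1 hee.2.2.1 he1
  have hltf : segHeight f x.1 < segHeight e' x.1 := by
    rw [← heqe, heqf]; exact segHeight_lt_of_slope_lt hff.2.1 hff.2.2.1 hf1
  have hev : ∀ᶠ t in 𝓝[<] x.1, segHeight f t < segHeight e' t ∧ segHeight e t < segHeight f' t ∧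
      e.1.1 < t ∧ f.1.1 < t ∧ t < x.1 := by
    filter_upwards [nhdsWithin_le_nhds ((continuous_segHeight f).continuousAt.eventually_lt
      (continuous_segHeight e').continuousAt hltf),
      nhdsWithin_le_nhds ((continuous_segHeight e).continuousAt.eventually_lt
      (continuous_segHeight f').continuousAt hlte),
      nhdsWithin_le_nhds (lt_mem_nhds he1), nhdsWithin_le_nhds (lt_mem_nhds hf1),
      self_mem_nhdsWithin] with t h1 h2 h3 h4 h5 using ⟨h1, h2, h3, h4, h5⟩
  obtain ⟨t, h1, h2, h3, h4, h5⟩ := hev.exists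
  rcases le_total (segHeight e' t) (segHeight f' t) with hle | hle
  · rcases h.eq_or_eq_of_mem_wedge hf hff hxf hee.1 h4 (hee.2.1 ▸ h3) h5 (h5.le.trans he2)
      h1.le hle with heq | heq
    · exact absurd h1 (by rw [heq]; exact lt_irrefl _)
    · exact h.eq_of_isNextEdge he hf hee (heq ▸ hff)
  · rcases h.eq_or_eq_of_mem_wedge he hee hxe hff.1 h3 (hff.2.1 ▸ h4) h5 (h5.le.trans hf2)
      h2.le hle with heq | heq
    · exact absurd h2 (by rw [heq]; exact lt_irrefl _)
    · exact h.eq_of_isNextEdge he hf (heq ▸ hee) hff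

theorem card_le (h : IsPlaneGraph V G) : #G ≤ 3 * #V := by
  set T := G.filter fun e => ∀ f, ¬ IsNextEdge G e f
  set A := G.filter fun e => ∃ x ∈ V, ∃ f, IsNextEdge G e f ∧ IsWedgeVertex V e f x ∧
    x.2 < segHeight f x.1
  set B := G.filter fun e => ∃ x ∈ V, ∃ f, IsNextEdge G e f ∧ IsWedgeVertex V e f x ∧
    x.2 = segHeight f x.1
  have hcover : G ⊆ T ∪ (A ∪ B) := fun e he => by
    by_cases hT : ∀ f, ¬ IsNextEdge G e f
    · exact mem_union_left _ (mem_filter.2 ⟨he, hT⟩)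
    · push Not at hT
      obtain ⟨f, hf⟩ := hT
      obtain ⟨x, hx⟩ := h.exists_isWedgeVertex he hf
      obtain ⟨hxV, -, -, -, -, hxf⟩ := mem_filter.1 hx.1
      refine mem_union_right _ ?_
      rcases hxf.lt_or_eq with hlt | heq
      · exact mem_union_left _ (mem_filter.2 ⟨he, x, hxV, f, hf, hx, hlt⟩)
      · exact mem_union_right _ (mem_filter.2 ⟨he, x, hxV, f, hf, hx, heq⟩)
  have hT : #T ≤ #V := by
    refine card_le_card_of_injOn Prod.fst (fun e he => h.left_mem e (mem_filter.1 he).1) ?_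
    have key : ∀ e ∈ T, ∀ f ∈ T, e.1 = f.1 → segSlope f ≤ segSlope e := fun e he f hf hef => by
      by_contra! hlt
      obtain ⟨g, hg, hmin⟩ := exists_min_image
        (G.filter fun g => g.1 = e.1 ∧ segSlope e < segSlope g) segSlope
        ⟨f, mem_filter.2 ⟨(mem_filter.1 hf).1, hef.symm, hlt⟩⟩
      obtain ⟨hgG, hg1, hg2⟩ := mem_filter.1 hg
      exact (mem_filter.1 he).2 g ⟨hgG, hg1, hg2, fun g' hg' h1 h2 =>
        hmin g' (mem_filter.2 ⟨hg', h1, h2⟩)⟩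
    exact fun e he f hf hef => h.eq_of_slope_eq (mem_filter.1 he).1 (mem_filter.1 hf).1 hef
      (le_antisymm (key f hf e he hef.symm) (key e he f hf hef))
  have hA : #A ≤ #V := by
    refine card_le_card_of_forall_subsingleton (fun e x => ∃ f, IsNextEdge G e f ∧
      IsWedgeVertex V e f x ∧ x.2 < segHeight f x.1) (fun e he => (mem_filter.1 he).2) ?_
    rintro x - e ⟨he, e', he1, he2, he3⟩ f ⟨hf, f', hf1, hf2, hf3⟩
    exact h.eq_of_isWedgeVertex_of_lt (mem_filter.1 he).1 (mem_filter.1 hf).1 he1 hf1 he2 hf2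
      he3 hf3
  have hB : #B ≤ #V := by
    refine card_le_card_of_forall_subsingleton (fun e x => ∃ f, IsNextEdge G e f ∧
      IsWedgeVertex V e f x ∧ x.2 = segHeight f x.1) (fun e he => (mem_filter.1 he).2) ?_
    rintro x - e ⟨he, e', he1, he2, he3⟩ f ⟨hf, f', hf1, hf2, hf3⟩
    exact h.eq_of_isWedgeVertex_of_eq (mem_filter.1 he).1 (mem_filter.1 hf).1 he1 hf1 he2 hf2
      he3 hf3
  have h1 := card_le_card hcover
  have h2 := card_union_le T (A ∪ B)
  have h3 := card_union_le A B
  omega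

end IsPlaneGraph

end PlaneGraph

section RichLines

open Finset
open scoped Classical

/-- The points of `P` on the line with slope `L.1` and intercept `L.2`. -/
noncomputable def lineTrace (P : Finset (ℝ × ℝ)) (L : ℝ × ℝ) : Finset (ℝ × ℝ) :=
  P.filter fun w => w.2 = L.1 * w.1 + L.2

/-- The segments between consecutive points of `P` on the line `L`. -/
noncomputable def lineSegments (P : Finset (ℝ × ℝ)) (L : ℝ × ℝ) :
    Finset ((ℝ × ℝ) × (ℝ × ℝ)) :=
  (lineTrace P L ×ˢ lineTrace P L).filter fun e => e.1.1 < e.2.1 ∧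
    ∀ w ∈ lineTrace P L, e.1.1 < w.1 → e.2.1 ≤ w.1

/-- The segments `e` and `f` cross at an interior point of both of them. -/
def SegmentsCross (e f : (ℝ × ℝ) × (ℝ × ℝ)) : Prop :=
  e ≠ f ∧ ∃ t, e.1.1 < t ∧ t < e.2.1 ∧ f.1.1 < t ∧ t < f.2.1 ∧ segHeight e t = segHeight f t

variable {P : Finset (ℝ × ℝ)} {L L' : ℝ × ℝ} {e f : (ℝ × ℝ) × (ℝ × ℝ)}

theorem mem_lineTrace {w : ℝ × ℝ} : w ∈ lineTrace P L ↔ w ∈ P ∧ w.2 = L.1 * w.1 + L.2 :=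
  mem_filter

theorem eq_of_two_common_abscissae {s t : ℝ} (hst : s ≠ t) (hs : L.1 * s + L.2 = L'.1 * s + L'.2)
    (ht : L.1 * t + L.2 = L'.1 * t + L'.2) : L = L' := by
  have h1 : (L.1 - L'.1) * (s - t) = 0 := by linarith
  have h2 : L.1 = L'.1 := by
    rcases mul_eq_zero.1 h1 with h | h
    · linarith
    · exact absurd (sub_eq_zero.1 h) hst
  refine Prod.ext h2 ?_
  rw [h2] at hs
  linarith

theorem mem_lineSegments : e ∈ lineSegments P L ↔
    (e.1 ∈ lineTrace P L ∧ e.2 ∈ lineTrace P L) ∧ e.1.1 < e.2.1 ∧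
      ∀ w ∈ lineTrace P L, e.1.1 < w.1 → e.2.1 ≤ w.1 := by
  rw [lineSegments, mem_filter, mem_product]

theorem segHeight_of_mem_lineSegments (he : e ∈ lineSegments P L) (t : ℝ) :
    segHeight e t = L.1 * t + L.2 := by
  obtain ⟨⟨h1, h2⟩, hlt, -⟩ := mem_lineSegments.1 he
  have h1' := (mem_lineTrace.1 h1).2
  have h2' := (mem_lineTrace.1 h2).2
  have hslope : segSlope e = L.1 := by
    rw [segSlope, div_eq_iff (sub_pos.2 hlt).ne', h1', h2']; ring
  rw [segHeight, hslope, h1']; ring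

theorem eq_of_mem_lineSegments (he : e ∈ lineSegments P L) (he' : e ∈ lineSegments P L') :
    L = L' := by
  have h := fun t => (segHeight_of_mem_lineSegments he t).symm.trans
    (segHeight_of_mem_lineSegments he' t)
  exact eq_of_two_common_abscissae zero_ne_one (h 0) (h 1)

theorem eq_of_mem_lineSegments_of_mem_interior (hP : Set.InjOn Prod.fst (P : Set (ℝ × ℝ)))
    (he : e ∈ lineSegments P L) (hf : f ∈ lineSegments P L) {t : ℝ} (he1 : e.1.1 < t)
    (he2 : t < e.2.1) (hf1 : f.1.1 < t) (hf2 : t < f.2.1) : e = f := by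
  obtain ⟨⟨h1, h2⟩, -, h3⟩ := mem_lineSegments.1 he
  obtain ⟨⟨h1', h2'⟩, -, h3'⟩ := mem_lineSegments.1 hf
  have hleft : e.1.1 = f.1.1 := by
    rcases lt_trichotomy e.1.1 f.1.1 with h | h | h
    · linarith [h3 f.1 h1' h]
    · exact h
    · linarith [h3' e.1 h1 h]
  have hright : e.2.1 = f.2.1 :=
    le_antisymm (h3 f.2 h2' (by linarith)) (h3' e.2 h2 (by linarith))
  exact Prod.ext (hP (mem_lineTrace.1 h1).1 (mem_lineTrace.1 h1').1 hleft)
    (hP (mem_lineTrace.1 h2).1 (mem_lineTrace.1 h2').1 hright)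

theorem card_lineTrace_le (hP : Set.InjOn Prod.fst (P : Set (ℝ × ℝ))) :
    #(lineTrace P L) ≤ #(lineSegments P L) + 1 := by
  rcases (lineTrace P L).eq_empty_or_nonempty with h0 | hne
  · simp [h0]
  obtain ⟨x, hx, hmax⟩ := exists_max_image _ Prod.fst hne
  have hsub : (lineTrace P L).erase x ⊆ (lineSegments P L).image Prod.fst := fun u hu => by
    obtain ⟨hux, huL⟩ := mem_erase.1 hu
    have hlt : u.1 < x.1 := (hmax u huL).lt_of_ne fun h =>
      hux (hP (mem_lineTrace.1 huL).1 (mem_lineTrace.1 hx).1 h)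
    obtain ⟨v, hv, hmin⟩ := exists_min_image ((lineTrace P L).filter fun w => u.1 < w.1) Prod.fst
      ⟨x, mem_filter.2 ⟨hx, hlt⟩⟩
    obtain ⟨hvL, huv⟩ := mem_filter.1 hv
    exact mem_image.2 ⟨(u, v), mem_lineSegments.2 ⟨⟨huL, hvL⟩, huv, fun w hw hlt' =>
      hmin w (mem_filter.2 ⟨hw, hlt'⟩)⟩, rfl⟩
  have h1 := (card_le_card hsub).trans card_image_le
  rw [card_erase_of_mem hx] at h1
  omega

theorem SegmentsCross.ne_line (hP : Set.InjOn Prod.fst (P : Set (ℝ × ℝ)))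
    (he : e ∈ lineSegments P L) (hf : f ∈ lineSegments P L') (h : SegmentsCross e f) :
    L ≠ L' := by
  rintro rfl
  obtain ⟨hne, t, h1, h2, h3, h4, -⟩ := h
  exact hne (eq_of_mem_lineSegments_of_mem_interior hP he hf h1 h2 h3 h4)

theorem SegmentsCross.card_endpoints (hP : Set.InjOn Prod.fst (P : Set (ℝ × ℝ)))
    (he : e ∈ lineSegments P L) (hf : f ∈ lineSegments P L') (h : SegmentsCross e f) :
    #({e.1, e.2, f.1, f.2} : Finset (ℝ × ℝ)) = 4 := by
  have hL := h.ne_line hP he hf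
  obtain ⟨-, t, h1, h2, h3, h4, h5⟩ := h
  rw [segHeight_of_mem_lineSegments he, segHeight_of_mem_lineSegments hf] at h5
  have key : ∀ w, w ∈ lineTrace P L → w ∈ lineTrace P L' → w.1 = t := fun w hw hw' => by
    by_contra hwt
    exact hL (eq_of_two_common_abscissae hwt
      ((mem_lineTrace.1 hw).2.symm.trans (mem_lineTrace.1 hw').2) h5)
  obtain ⟨⟨he1, he2⟩, hlt, -⟩ := mem_lineSegments.1 he
  obtain ⟨⟨hf1, hf2⟩, hlt', -⟩ := mem_lineSegments.1 hf
  have n12 : e.1 ≠ e.2 := fun h => hlt.ne (by rw [h])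
  have n34 : f.1 ≠ f.2 := fun h => hlt'.ne (by rw [h])
  have n13 : e.1 ≠ f.1 := fun h => h1.ne (key e.1 he1 (h ▸ hf1))
  have n14 : e.1 ≠ f.2 := fun h => h1.ne (key e.1 he1 (h ▸ hf2))
  have n23 : e.2 ≠ f.1 := fun h => h2.ne' (key e.2 he2 (h ▸ hf1))
  have n24 : e.2 ≠ f.2 := fun h => h2.ne' (key e.2 he2 (h ▸ hf2))
  rw [card_insert_of_notMem (by simp [n12, n13, n14]), card_insert_of_notMem (by simp [n23, n24]),
    card_pair n34]

/-- All segments between consecutive points of `P` on the lines in `M`. -/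
noncomputable def allSegments (P M : Finset (ℝ × ℝ)) : Finset ((ℝ × ℝ) × (ℝ × ℝ)) :=
  M.biUnion (lineSegments P)

/-- The ordered pairs of crossing segments. -/
noncomputable def crossings (P M : Finset (ℝ × ℝ)) :
    Finset (((ℝ × ℝ) × (ℝ × ℝ)) × ((ℝ × ℝ) × (ℝ × ℝ))) :=
  (allSegments P M ×ˢ allSegments P M).filter fun c => SegmentsCross c.1 c.2

variable {M : Finset (ℝ × ℝ)}

theorem mem_allSegments : e ∈ allSegments P M ↔ ∃ L ∈ M, e ∈ lineSegments P L := mem_biUnion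

theorem card_allSegments_ge (hP : Set.InjOn Prod.fst (P : Set (ℝ × ℝ))) {s : ℕ}
    (hM : ∀ L ∈ M, s ≤ #(lineTrace P L)) : (s - 1) * #M ≤ #(allSegments P M) := by
  rw [allSegments, card_biUnion fun L _ L' _ hne => disjoint_left.2 fun e he he' =>
    hne (eq_of_mem_lineSegments he he'), mul_comm, ← smul_eq_mul]
  refine card_nsmul_le_sum _ _ _ fun L hL => ?_
  have := hM L hL
  have := card_lineTrace_le (L := L) hP
  omega

theorem card_crossings_le (hP : Set.InjOn Prod.fst (P : Set (ℝ × ℝ))) :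
    #(crossings P M) ≤ #M ^ 2 := by
  rw [sq, ← card_product]
  refine card_le_card_of_forall_subsingleton
    (fun c l => c.1 ∈ lineSegments P l.1 ∧ c.2 ∈ lineSegments P l.2) (fun c hc => ?_) ?_
  · obtain ⟨hc, -⟩ := mem_filter.1 hc
    obtain ⟨h1, h2⟩ := mem_product.1 hc
    obtain ⟨L, hL, hcL⟩ := mem_allSegments.1 h1
    obtain ⟨L', hL', hcL'⟩ := mem_allSegments.1 h2
    exact ⟨(L, L'), mem_product.2 ⟨hL, hL'⟩, hcL, hcL'⟩
  · rintro ⟨L, L'⟩ - ⟨e, f⟩ ⟨hef, he, hf⟩ ⟨e', f'⟩ ⟨hef', he', hf'⟩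
    have hc := (mem_filter.1 hef).2
    have hc' := (mem_filter.1 hef').2
    dsimp only at he hf he' hf' hc hc'
    have hne := hc.ne_line hP he hf
    obtain ⟨-, t, h1, h2, h3, h4, h5⟩ := hc
    obtain ⟨-, t', h1', h2', h3', h4', h5'⟩ := hc'
    rw [segHeight_of_mem_lineSegments he, segHeight_of_mem_lineSegments hf] at h5
    rw [segHeight_of_mem_lineSegments he', segHeight_of_mem_lineSegments hf'] at h5'
    have htt : t = t' := by
      by_contra htt
      exact hne (eq_of_two_common_abscissae htt h5 h5')
    subst htt
    exact Prod.ext (eq_of_mem_lineSegments_of_mem_interior hP he he' h1 h2 h1' h2')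
      (eq_of_mem_lineSegments_of_mem_interior hP hf hf' h3 h4 h3' h4')

theorem card_segments_le {S : Finset (ℝ × ℝ)} (hS : S ⊆ P) :
    #((allSegments P M).filter fun e => ({e.1, e.2} : Finset (ℝ × ℝ)) ⊆ S) ≤
      #((crossings P M).filter fun c => ({c.1.1, c.1.2, c.2.1, c.2.2} : Finset (ℝ × ℝ)) ⊆ S) +
        3 * #S := by
  set E := (allSegments P M).filter fun e => ({e.1, e.2} : Finset (ℝ × ℝ)) ⊆ S with hE
  set X := (crossings P M).filter
    fun c => ({c.1.1, c.1.2, c.2.1, c.2.2} : Finset (ℝ × ℝ)) ⊆ S with hX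
  have hmem : ∀ e ∈ E, (∃ L ∈ M, e ∈ lineSegments P L) ∧ e.1 ∈ S ∧ e.2 ∈ S := fun e he => by
    obtain ⟨h1, h2⟩ := mem_filter.1 he
    exact ⟨mem_allSegments.1 h1, h2 (by simp), h2 (by simp)⟩
  have hplane : IsPlaneGraph S (E \ X.image Prod.fst) := by
    refine ⟨fun e he => (hmem e (mem_sdiff.1 he).1).2.1,
      fun e he => (hmem e (mem_sdiff.1 he).1).2.2, fun e he => ?_, fun e he w hw h1 h2 h3 => ?_,
      fun e he f hf t h1 h2 h3 h4 h5 => ?_⟩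
    · obtain ⟨⟨L, -, hL⟩, -⟩ := hmem e (mem_sdiff.1 he).1
      exact (mem_lineSegments.1 hL).2.1
    · obtain ⟨⟨L, -, hL⟩, -⟩ := hmem e (mem_sdiff.1 he).1
      rw [segHeight_of_mem_lineSegments hL] at h3
      exact absurd ((mem_lineSegments.1 hL).2.2 w (mem_lineTrace.2 ⟨hS hw, h3.symm⟩) h1) h2.not_ge
    · by_contra hne
      obtain ⟨heE, heX⟩ := mem_sdiff.1 he
      obtain ⟨hfE, -⟩ := mem_sdiff.1 hf
      refine heX (mem_image.2 ⟨(e, f), mem_filter.2 ⟨mem_filter.2 ⟨mem_product.2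
        ⟨(mem_filter.1 heE).1, (mem_filter.1 hfE).1⟩, hne, t, h1, h2, h3, h4, h5⟩, ?_⟩, rfl⟩)
      have := (hmem e heE).2
      have := (hmem f hfE).2
      simp_all [insert_subset_iff]
  have h1 := hplane.card_le
  have h2 := le_card_sdiff (X.image Prod.fst) E
  have h3 : #(X.image Prod.fst) ≤ #X := card_image_le
  omega

theorem card_segments_sampled (hP : Set.InjOn Prod.fst (P : Set (ℝ × ℝ))) {p : ℝ} (hp0 : 0 ≤ p)
    (hp1 : p ≤ 1) : p ^ 2 * #(allSegments P M) ≤ p ^ 4 * (#M : ℝ) ^ 2 + 3 * (p * #P) := by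
  obtain ⟨S, hS, hle⟩ := exists_samplingMean_le (V := P) hp0 hp1 fun S =>
    ((#((allSegments P M).filter fun e => ({e.1, e.2} : Finset (ℝ × ℝ)) ⊆ S) : ℝ) -
      #((crossings P M).filter fun c => ({c.1.1, c.1.2, c.2.1, c.2.2} : Finset (ℝ × ℝ)) ⊆ S)) -
      3 * (#S : ℝ)
  have hS' : (#((allSegments P M).filter fun e => ({e.1, e.2} : Finset (ℝ × ℝ)) ⊆ S) : ℝ) ≤
      #((crossings P M).filter fun c => ({c.1.1, c.1.2, c.2.1, c.2.2} : Finset (ℝ × ℝ)) ⊆ S) +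
      3 * (#S : ℝ) := by exact_mod_cast card_segments_le hS
  have hseg : ∀ e ∈ allSegments P M, e.1 ∈ P ∧ e.2 ∈ P ∧ e.1 ≠ e.2 := fun e he => by
    obtain ⟨L, -, hL⟩ := mem_allSegments.1 he
    obtain ⟨⟨h1, h2⟩, h3, -⟩ := mem_lineSegments.1 hL
    exact ⟨(mem_lineTrace.1 h1).1, (mem_lineTrace.1 h2).1, fun h => h3.ne (by rw [h])⟩
  rw [samplingMean_sub, samplingMean_sub, samplingMean_const_mul, samplingMean_card,
    samplingMean_card_filter, samplingMean_card_filter] at hle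
  · have h1 : ∑ e ∈ allSegments P M, p ^ #({e.1, e.2} : Finset (ℝ × ℝ)) =
        p ^ 2 * #(allSegments P M) := by
      rw [sum_congr rfl fun e he => by rw [card_pair (hseg e he).2.2], sum_const, nsmul_eq_mul,
        mul_comm]
    have h2 : ∑ c ∈ crossings P M, p ^ #({c.1.1, c.1.2, c.2.1, c.2.2} : Finset (ℝ × ℝ)) =
        p ^ 4 * #(crossings P M) := by
      rw [sum_congr rfl fun c hc => ?_, sum_const, nsmul_eq_mul, mul_comm]
      obtain ⟨hc, hcross⟩ := mem_filter.1 hc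
      obtain ⟨h1, h2⟩ := mem_product.1 hc
      obtain ⟨L, -, hL⟩ := mem_allSegments.1 h1
      obtain ⟨L', -, hL'⟩ := mem_allSegments.1 h2
      rw [hcross.card_endpoints hP hL hL']
    have h3 : (#(crossings P M) : ℝ) ≤ (#M : ℝ) ^ 2 := by exact_mod_cast card_crossings_le hP
    have h4 := mul_le_mul_of_nonneg_left h3 (pow_nonneg hp0 4)
    linarith
  · intro c hc
    obtain ⟨h1, h2⟩ := mem_product.1 (mem_filter.1 hc).1
    have := hseg _ h1
    have := hseg _ h2
    simp_all [insert_subset_iff]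
  · intro e he
    have := hseg _ he
    simp_all [insert_subset_iff]

/-- The Szemerédi-Trotter bound for the number of lines with at least `s` points. -/
theorem card_richLines (hP : Set.InjOn Prod.fst (P : Set (ℝ × ℝ))) {s : ℕ} (hs : 2 ≤ s)
    (hM : ∀ L ∈ M, s ≤ #(lineTrace P L)) :
    (s : ℝ) ^ 3 * #M ≤ 576 * (#P : ℝ) ^ 2 ∨ (s : ℝ) * #M ≤ 12 * #P := by
  have hE : (s : ℝ) * #M ≤ 2 * #(allSegments P M) := by
    have h1 := card_allSegments_ge hP hM
    have h2 : s * #M ≤ 2 * ((s - 1) * #M) := by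
      rw [← mul_assoc]
      exact Nat.mul_le_mul_right _ (by omega)
    exact_mod_cast h2.trans (Nat.mul_le_mul_left 2 h1)
  have hs0 : (0 : ℝ) < s := by exact_mod_cast (by omega : 0 < s)
  rcases le_or_gt (s : ℝ) (4 * #M) with hsM | hsM
  · left
    have hM0 : (0 : ℝ) < #M := by linarith
    set p := √((s : ℝ) / (4 * #M)) with hp
    have hp0 : 0 < p := Real.sqrt_pos.2 (by positivity)
    have hp2 : p ^ 2 * (4 * #M) = s := by
      rw [hp, Real.sq_sqrt (by positivity)]
      field_simp
    have hp1 : p ≤ 1 := Real.sqrt_le_one.2 ((div_le_one (by positivity)).2 hsM)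
    have h := card_segments_sampled (M := M) hP hp0.le hp1
    have h' : p * #(allSegments P M) ≤ p * (s * #M / 4) + 3 * #P := by
      have e1 : p ^ 4 * (#M : ℝ) ^ 2 = p * (p * (s * #M / 4)) := by rw [← hp2]; ring
      rw [e1] at h
      refine le_of_mul_le_mul_left ?_ hp0
      linarith
    have h2 := mul_le_mul_of_nonneg_left hE hp0.le
    have h3 : p * (s * #M) ≤ 12 * #P := by linarith
    have h4 := pow_le_pow_left₀ (by positivity) h3 2
    have h5 : (p * (s * #M)) ^ 2 = s ^ 3 * #M / 4 := by
      calc (p * (s * #M)) ^ 2 = (p ^ 2 * (4 * #M)) * (s ^ 2 * #M / 4) := by ring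
        _ = _ := by rw [hp2]; ring
    linarith
  · right
    have h := card_segments_sampled (M := M) (p := 1) hP zero_le_one le_rfl
    have h2 : (#M : ℝ) ^ 2 ≤ s * #M / 4 := by nlinarith [Nat.cast_nonneg (α := ℝ) #M]
    linarith

end RichLines

section SpannedLines

open Finset
open scoped Classical

/-- The nonvertical lines spanned by `P`, as pairs of slope and intercept. -/
noncomputable def spannedLines (P : Finset (ℝ × ℝ)) : Finset (ℝ × ℝ) :=
  ((P ×ˢ P).filter fun e => e.1.1 < e.2.1).image
    fun e => (segSlope e, e.1.2 - segSlope e * e.1.1)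

variable {P : Finset (ℝ × ℝ)} {L L' : ℝ × ℝ}

theorem exists_mem_spannedLines {u v : ℝ × ℝ} (hu : u ∈ P) (hv : v ∈ P) (huv : u.1 < v.1) :
    ∃ L ∈ spannedLines P, u ∈ lineTrace P L ∧ v ∈ lineTrace P L := by
  refine ⟨_, mem_image.2 ⟨(u, v), mem_filter.2 ⟨mem_product.2 ⟨hu, hv⟩, huv⟩, rfl⟩,
    mem_lineTrace.2 ⟨hu, by dsimp only; ring⟩, mem_lineTrace.2 ⟨hv, ?_⟩⟩
  have h := segHeight_right (e := (u, v)) huv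
  simp only [segHeight] at h
  dsimp only
  linarith

theorem two_le_card_lineTrace (hL : L ∈ spannedLines P) : 2 ≤ #(lineTrace P L) := by
  obtain ⟨⟨u, v⟩, he, rfl⟩ := mem_image.1 hL
  obtain ⟨h, huv⟩ := mem_filter.1 he
  obtain ⟨hu, hv⟩ := mem_product.1 h
  have h := segHeight_right (e := (u, v)) huv
  simp only [segHeight] at h
  exact one_lt_card.2 ⟨u, mem_lineTrace.2 ⟨hu, by dsimp only; ring⟩, v,
    mem_lineTrace.2 ⟨hv, by dsimp only; linarith⟩, fun huv' => huv.ne (by rw [huv'])⟩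

theorem eq_of_two_common_points (hP : Set.InjOn Prod.fst (P : Set (ℝ × ℝ))) {u v : ℝ × ℝ}
    (hu : u ∈ lineTrace P L) (hv : v ∈ lineTrace P L) (hu' : u ∈ lineTrace P L')
    (hv' : v ∈ lineTrace P L') (huv : u ≠ v) : L = L' :=
  eq_of_two_common_abscissae
    (fun h => huv (hP (mem_lineTrace.1 hu).1 (mem_lineTrace.1 hv).1 h))
    ((mem_lineTrace.1 hu).2.symm.trans (mem_lineTrace.1 hu').2)
    ((mem_lineTrace.1 hv).2.symm.trans (mem_lineTrace.1 hv').2)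

theorem succ_pow_succ_le (a k : ℕ) : (a + 1) ^ (k + 1) ≤ a ^ (k + 1) + (k + 1) * (a + 1) ^ k := by
  induction k with
  | zero => simp
  | succ k ih =>
    have h1 := Nat.mul_le_mul_left (a + 1) ih
    have h2 : a ^ (k + 1) ≤ (a + 1) ^ (k + 1) := Nat.pow_le_pow_left (by omega) _
    calc (a + 1) ^ (k + 1 + 1) = (a + 1) * (a + 1) ^ (k + 1) := by ring
      _ ≤ (a + 1) * (a ^ (k + 1) + (k + 1) * (a + 1) ^ k) := h1
      _ = a ^ (k + 1 + 1) + (k + 1) * (a + 1) ^ (k + 1) + a ^ (k + 1) := by ring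
      _ ≤ a ^ (k + 1 + 1) + (k + 1) * (a + 1) ^ (k + 1) + (a + 1) ^ (k + 1) := by omega
      _ = _ := by ring

theorem pow_succ_le_sum (k : ℕ) {a : ℕ} (ha : 2 ≤ a) :
    a ^ (k + 1) ≤ 2 * (k + 1) * ∑ s ∈ Icc 2 a, s ^ k := by
  induction a, ha using Nat.le_induction with
  | base =>
    simp only [Icc_self, sum_singleton]
    rw [pow_succ]
    nlinarith [Nat.zero_le (k * 2 ^ k)]
  | succ a ha ih =>
    rw [sum_Icc_succ_top (by omega), mul_add]
    have := succ_pow_succ_le a k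
    nlinarith [Nat.zero_le ((k + 1) * (a + 1) ^ k)]

/-- A weighted count of the incidences between `P` and the lines it spans. -/
theorem sum_card_lineTrace_pow_le (hP : Set.InjOn Prod.fst (P : Set (ℝ × ℝ))) {ℓ k : ℕ} {D : ℝ}
    (hk : 3 ≤ k) (hℓ : ∀ L ∈ spannedLines P, #(lineTrace P L) ≤ ℓ) (hD : (ℓ : ℝ) ^ 2 ≤ D * #P) :
    ∑ L ∈ spannedLines P, (#(lineTrace P L) : ℝ) ^ (k + 1) ≤
      2 * (k + 1) * (576 + 12 * D) * ((#P : ℝ) ^ 2 * (ℓ : ℝ) ^ (k - 2)) := by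
  have hrich : ∀ s ∈ Icc 2 ℓ, (s : ℝ) ^ k *
      #((spannedLines P).filter fun L => s ≤ #(lineTrace P L)) ≤
      (576 + 12 * D) * (#P : ℝ) ^ 2 * (ℓ : ℝ) ^ (k - 3) := fun s hs => by
    obtain ⟨hs2, hsℓ⟩ := mem_Icc.1 hs
    set N : ℝ := ((#((spannedLines P).filter fun L => s ≤ #(lineTrace P L)) : ℕ) : ℝ) with hN
    have hsR : (s : ℝ) ≤ ℓ := by exact_mod_cast hsℓ
    have hsq : (s : ℝ) ^ 2 ≤ D * #P := (pow_le_pow_left₀ (by positivity) hsR 2).trans hD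
    have hDP : 0 ≤ D * #P := (sq_nonneg _).trans hsq
    have hDP' : 0 ≤ D * (#P : ℝ) ^ 2 := by
      rw [sq, ← mul_assoc]; positivity
    have h3 : (s : ℝ) ^ 3 * N ≤ (576 + 12 * D) * (#P : ℝ) ^ 2 := by
      rcases card_richLines (M := (spannedLines P).filter fun L => s ≤ #(lineTrace P L)) hP hs2
        (fun L hL => (mem_filter.1 hL).2) with h | h
      · rw [← hN] at h
        linarith
      · rw [← hN] at h
        have h1 := mul_le_mul hsq h (by positivity) hDP
        have h2 : 0 ≤ 576 * (#P : ℝ) ^ 2 := by positivity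
        nlinarith
    have hpow : (s : ℝ) ^ (k - 3) ≤ (ℓ : ℝ) ^ (k - 3) := pow_le_pow_left₀ (by positivity) hsR _
    calc (s : ℝ) ^ k * N = (s : ℝ) ^ 3 * N * (s : ℝ) ^ (k - 3) := by
          nth_rewrite 1 [show k = 3 + (k - 3) by omega]
          rw [pow_add]; ring
      _ ≤ _ := mul_le_mul h3 hpow (by positivity)
          ((by positivity : (0 : ℝ) ≤ (s : ℝ) ^ 3 * N).trans h3)
  calc ∑ L ∈ spannedLines P, (#(lineTrace P L) : ℝ) ^ (k + 1)
      ≤ ∑ L ∈ spannedLines P, 2 * (k + 1) *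
          ∑ s ∈ (Icc 2 ℓ).filter fun s => s ≤ #(lineTrace P L), (s : ℝ) ^ k := by
        refine sum_le_sum fun L hL => ?_
        have h1 := pow_succ_le_sum k (two_le_card_lineTrace hL)
        have h2 : (Icc 2 ℓ).filter (fun s => s ≤ #(lineTrace P L)) =
            Icc 2 #(lineTrace P L) := by
          have := hℓ L hL
          ext s
          simp only [mem_filter, mem_Icc]
          omega
        rw [h2]
        exact_mod_cast h1
    _ = 2 * (k + 1) * ∑ s ∈ Icc 2 ℓ, (s : ℝ) ^ k *
          #((spannedLines P).filter fun L => s ≤ #(lineTrace P L)) := by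
        rw [← mul_sum]
        congr 1
        simp only [sum_filter, card_filter, Nat.cast_sum, mul_sum]
        rw [sum_comm]
        exact sum_congr rfl fun s _ => sum_congr rfl fun L _ => by split_ifs <;> simp
    _ ≤ 2 * (k + 1) * ∑ s ∈ Icc 2 ℓ, (576 + 12 * D) * (#P : ℝ) ^ 2 * (ℓ : ℝ) ^ (k - 3) := by
        exact mul_le_mul_of_nonneg_left (sum_le_sum hrich) (by positivity)
    _ ≤ 2 * (k + 1) * ((576 + 12 * D) * ((#P : ℝ) ^ 2 * (ℓ : ℝ) ^ (k - 2))) := by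
        gcongr
        rw [sum_const, nsmul_eq_mul, Nat.card_Icc]
        rcases Nat.lt_or_ge ℓ 2 with hlt | hge
        · rw [show ℓ + 1 - 2 = 0 by omega]
          have hDP : 0 ≤ D * (#P : ℝ) ^ 2 := by
            have := (sq_nonneg (ℓ : ℝ)).trans hD
            rw [sq, ← mul_assoc]; positivity
          have : 0 ≤ ((576 + 12 * D) * (#P : ℝ) ^ 2) * (ℓ : ℝ) ^ (k - 2) :=
            mul_nonneg (by linarith [sq_nonneg (#P : ℝ)]) (by positivity)
          simpa [mul_assoc] using this
        · have hc : ((ℓ + 1 - 2 : ℕ) : ℝ) ≤ ℓ := by exact_mod_cast (by omega : ℓ + 1 - 2 ≤ ℓ)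
          have h0 := (by positivity : (0 : ℝ) ≤ (2 : ℕ) ^ k *
            #((spannedLines P).filter fun L => 2 ≤ #(lineTrace P L))).trans
            (hrich 2 (mem_Icc.2 ⟨le_rfl, hge⟩))
          calc _ ≤ (ℓ : ℝ) * ((576 + 12 * D) * (#P : ℝ) ^ 2 * (ℓ : ℝ) ^ (k - 3)) :=
                mul_le_mul_of_nonneg_right hc h0
            _ = _ := by
                rw [show k - 2 = k - 3 + 1 by omega, pow_succ]; ring
    _ = _ := by ring

end SpannedLines

/-- A family of subsets `tr L`, `L ∈ M`, of `V`, called lines, such that two distinct lines share at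
most one point. -/
structure PartialLinearSpace {α ι : Type*} (V : Finset α) (M : Finset ι) (tr : ι → Finset α) :
    Prop where
  subset : ∀ L ∈ M, tr L ⊆ V
  linear : ∀ L ∈ M, ∀ L' ∈ M, ∀ x y, x ∈ tr L → y ∈ tr L → x ∈ tr L' → y ∈ tr L' → x ≠ y → L = L'

section PartialLinearSpace

open Finset
open scoped Classical

variable {α ι : Type*} {V R Q : Finset α} {M : Finset ι} {tr : ι → Finset α} {k ℓ Δ : ℕ}

/-- The `r`-element sets of collinear points. -/
noncomputable def collinearSets (M : Finset ι) (tr : ι → Finset α) (r : ℕ) : Finset (Finset α) :=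
  M.biUnion fun L => powersetCard r (tr L)

/-- The `k`-element sets that are collinear with `u` and do not contain `u`. -/
noncomputable def petals (M : Finset ι) (tr : ι → Finset α) (k : ℕ) (u : α) :
    Finset (Finset α) :=
  (M.filter fun L => u ∈ tr L).biUnion fun L => powersetCard k ((tr L).erase u)

/-- The points on the lines through `x` and `y`. -/
noncomputable def lineThrough (M : Finset ι) (tr : ι → Finset α) (x y : α) : Finset α :=
  (M.filter fun L => x ∈ tr L ∧ y ∈ tr L).biUnion tr

/-- The `(2 * k + 2)`-element sets formed by two collinear `(k + 1)`-element sets through a common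
point together with a further point on a line that meets both of them. -/
noncomputable def triangleSets (V : Finset α) (M : Finset ι) (tr : ι → Finset α) (k : ℕ) :
    Finset (Finset α) :=
  (V.biUnion fun u => (petals M tr k u ×ˢ petals M tr k u).biUnion fun a =>
    ((a.1 ×ˢ a.2).filter fun x => x.1 ≠ x.2).biUnion fun x =>
      (lineThrough M tr x.1 x.2).image fun w => insert w (insert u (a.1 ∪ a.2))).filter
    fun T => #T = 2 * k + 2

theorem mem_collinearSets {r : ℕ} {T : Finset α} :
    T ∈ collinearSets M tr r ↔ ∃ L ∈ M, T ⊆ tr L ∧ #T = r := by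
  simp only [collinearSets, mem_biUnion, mem_powersetCard]

theorem mem_petals {u : α} {A : Finset α} :
    A ∈ petals M tr k u ↔ ∃ L ∈ M, u ∈ tr L ∧ A ⊆ (tr L).erase u ∧ #A = k := by
  simp only [petals, mem_biUnion, mem_powersetCard, mem_filter, and_assoc]

namespace PartialLinearSpace

theorem sum_card_pow_le (h : PartialLinearSpace V M tr)
    (hΔ : ∀ x ∈ V, ∑ L ∈ M with x ∈ tr L, #(tr L) ^ k ≤ Δ) :
    ∑ L ∈ M, #(tr L) ^ (k + 1) ≤ #V * Δ := by
  calc ∑ L ∈ M, #(tr L) ^ (k + 1) = ∑ L ∈ M, ∑ x ∈ V with x ∈ tr L, #(tr L) ^ k := by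
        refine sum_congr rfl fun L hL => ?_
        rw [sum_const, smul_eq_mul, filter_mem_eq_inter, inter_eq_right.2 (h.subset L hL), pow_succ,
          mul_comm]
    _ = ∑ x ∈ V, ∑ L ∈ M with x ∈ tr L, #(tr L) ^ k := by
        simp only [sum_filter]
        exact sum_comm
    _ ≤ #V * Δ := by
        rw [← smul_eq_mul]
        exact sum_le_card_nsmul _ _ _ hΔ

theorem card_collinearSets_le (h : PartialLinearSpace V M tr)
    (hΔ : ∀ x ∈ V, ∑ L ∈ M with x ∈ tr L, #(tr L) ^ k ≤ Δ) :
    #(collinearSets M tr (k + 1)) ≤ #V * Δ := by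
  refine (card_biUnion_le.trans (sum_le_sum fun L _ => ?_)).trans (h.sum_card_pow_le hΔ)
  rw [card_powersetCard]
  exact Nat.choose_le_pow _ _

theorem card_collinearSets_succ_le (h : PartialLinearSpace V M tr) (hℓ : ∀ L ∈ M, #(tr L) ≤ ℓ)
    (hΔ : ∀ x ∈ V, ∑ L ∈ M with x ∈ tr L, #(tr L) ^ k ≤ Δ) :
    #(collinearSets M tr (k + 2)) ≤ #V * Δ * ℓ := by
  refine (card_biUnion_le.trans (sum_le_sum fun L hL => ?_)).trans
    ((sum_mul _ _ _).symm.le.trans (Nat.mul_le_mul_right ℓ (h.sum_card_pow_le hΔ)))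
  rw [card_powersetCard]
  refine (Nat.choose_le_pow _ _).trans ?_
  rw [show k + 2 = k + 1 + 1 from rfl, pow_succ]
  exact Nat.mul_le_mul_left _ (hℓ L hL)

theorem card_petals_le (hΔ : ∀ x ∈ V, ∑ L ∈ M with x ∈ tr L, #(tr L) ^ k ≤ Δ) {u : α}
    (hu : u ∈ V) : #(petals M tr k u) ≤ Δ := by
  refine (card_biUnion_le.trans (sum_le_sum fun L _ => ?_)).trans (hΔ u hu)
  rw [card_powersetCard]
  exact (Nat.choose_le_pow _ _).trans (Nat.pow_le_pow_left (card_le_card (erase_subset _ _)) _)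

theorem card_lineThrough_le (h : PartialLinearSpace V M tr) (hℓ : ∀ L ∈ M, #(tr L) ≤ ℓ)
    {x y : α} (hxy : x ≠ y) : #(lineThrough M tr x y) ≤ ℓ := by
  have hone : #(M.filter fun L => x ∈ tr L ∧ y ∈ tr L) ≤ 1 := by
    refine card_le_one.2 fun L hL L' hL' => ?_
    obtain ⟨hLM, hx, hy⟩ := mem_filter.1 hL
    obtain ⟨hLM', hx', hy'⟩ := mem_filter.1 hL'
    exact h.linear L hLM L' hLM' x y hx hy hx' hy' hxy
  calc #(lineThrough M tr x y) ≤ _ :=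
        card_biUnion_le_card_mul _ _ ℓ fun L hL => hℓ L (mem_filter.1 hL).1
    _ ≤ 1 * ℓ := Nat.mul_le_mul_right _ hone
    _ = ℓ := one_mul _

theorem card_triangleSets_le (h : PartialLinearSpace V M tr) (hℓ : ∀ L ∈ M, #(tr L) ≤ ℓ)
    (hΔ : ∀ x ∈ V, ∑ L ∈ M with x ∈ tr L, #(tr L) ^ k ≤ Δ) :
    #(triangleSets V M tr k) ≤ #V * (Δ * Δ * (k * k * ℓ)) := by
  refine (card_filter_le _ _).trans (card_biUnion_le_card_mul _ _ _ fun u hu => ?_)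
  have hp := card_petals_le hΔ hu
  refine (card_biUnion_le_card_mul _ _ (k * k * ℓ) fun a ha => ?_).trans
    (Nat.mul_le_mul_right _ ?_)
  · obtain ⟨ha1, ha2⟩ := mem_product.1 ha
    obtain ⟨-, -, -, -, hc1⟩ := mem_petals.1 ha1
    obtain ⟨-, -, -, -, hc2⟩ := mem_petals.1 ha2
    refine (card_biUnion_le_card_mul _ _ ℓ fun x hx => card_image_le.trans
      (h.card_lineThrough_le hℓ (mem_filter.1 hx).2)).trans (Nat.mul_le_mul_right _ ?_)
    refine (card_filter_le _ _).trans ?_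
    rw [card_product, hc1, hc2]
  · rw [card_product]
    exact Nat.mul_le_mul hp hp

/-- A set of points without `k + 2` collinear points and without triangles gives rise to a sparse
hypergraph. -/
theorem sparseHypergraph (h : PartialLinearSpace V M tr) (hk : 2 ≤ k) (hQV : Q ⊆ V)
    (hcol : ∀ T ∈ collinearSets M tr (k + 2), ¬ T ⊆ Q)
    (htri : ∀ T ∈ triangleSets V M tr k, ¬ T ⊆ Q) :
    SparseHypergraph k Q ((collinearSets M tr (k + 1)).filter fun T => T ⊆ Q) id := by
  have hno : ∀ L ∈ M, ∀ T ⊆ tr L, T ⊆ Q → #T < k + 2 := fun L hL T hT hTQ => by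
    by_contra! hc
    obtain ⟨T', hT', hcard⟩ := exists_subset_card_eq hc
    exact hcol T' (mem_collinearSets.2 ⟨L, hL, hT'.trans hT, hcard⟩) (hT'.trans hTQ)
  have hmem : ∀ T ∈ (collinearSets M tr (k + 1)).filter fun T => T ⊆ Q,
      (∃ L ∈ M, T ⊆ tr L) ∧ #T = k + 1 ∧ T ⊆ Q := fun T hT => by
    obtain ⟨hT, hTQ⟩ := mem_filter.1 hT
    obtain ⟨L, hL, hTL, hc⟩ := mem_collinearSets.1 hT
    exact ⟨⟨L, hL, hTL⟩, hc, hTQ⟩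
  have hlin : ∀ T ∈ (collinearSets M tr (k + 1)).filter fun T => T ⊆ Q, ∀ L ∈ M, T ⊆ tr L →
      ∀ x ∈ tr L, x ∈ Q → x ∈ T := fun T hT L hL hTL x hx hxQ => by
    by_contra hxT
    obtain ⟨-, hc, hTQ⟩ := hmem T hT
    have := hno L hL (insert x T) (insert_subset hx hTL) (insert_subset hxQ hTQ)
    rw [card_insert_of_notMem hxT] at this
    omega
  refine ⟨fun T hT => (hmem T hT).2.2, fun T hT => ?_, fun T hT => (hmem T hT).2.1.le,
    fun e he j hj x hx y hy hxj hyj hxy => ?_,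
    fun e he j hj j' hj' v hve u hu u' hu' huj hvj huj' hvj' => ?_⟩
  · have := (hmem T hT).2.1
    simp only [id]
    omega
  · obtain ⟨⟨L, hL, heL⟩, hc, heQ⟩ := hmem e he
    obtain ⟨⟨L', hL', hjL'⟩, hc', hjQ⟩ := hmem j hj
    obtain rfl := h.linear L hL L' hL' x y (heL hx) (heL hy) (hjL' hxj) (hjL' hyj) hxy
    exact eq_of_subset_of_card_le (fun z hz => hlin j hj L hL hjL' z (heL hz) (heQ hz))
      (by omega)
  · by_contra huu
    simp only [id] at hve hu hu' huj hvj huj' hvj'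
    obtain ⟨⟨L, hL, heL⟩, hc, heQ⟩ := hmem e he
    obtain ⟨⟨L₁, hL₁, hjL⟩, hc₁, hjQ⟩ := hmem j hj
    obtain ⟨⟨L₂, hL₂, hjL'⟩, hc₂, hjQ'⟩ := hmem j' hj'
    have hvL : v ∉ tr L := fun hv => hve (hlin e he L hL heL v hv (hjQ hvj))
    have hLL₁ : L ≠ L₁ := fun hh => hvL (hh ▸ hjL hvj)
    have hLL₂ : L ≠ L₂ := fun hh => hvL (hh ▸ hjL' hvj')
    have hL₁₂ : L₁ ≠ L₂ := fun hh => hLL₁ (h.linear L hL L₁ hL₁ u u' (heL hu) (heL hu') (hjL huj)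
      (hh ▸ hjL' huj') huu)
    have huv : u ≠ v := fun hh => hve (hh ▸ hu)
    have huv' : u' ≠ v := fun hh => hve (hh ▸ hu')
    obtain ⟨w, hwe, hwuu⟩ : ∃ w ∈ e, w ∉ ({u, u'} : Finset α) := by
      refine exists_mem_notMem_of_card_lt_card ?_
      rw [card_pair huu, hc]
      omega
    simp only [mem_insert, mem_singleton, not_or] at hwuu
    have hwj : w ∉ j := fun hw => hLL₁ (h.linear L hL L₁ hL₁ w u (heL hwe) (heL hu) (hjL hw)
      (hjL huj) hwuu.1)
    have hwj' : w ∉ j' := fun hw => hLL₂ (h.linear L hL L₂ hL₂ w u' (heL hwe) (heL hu') (hjL' hw)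
      (hjL' huj') hwuu.2)
    have hdisj : Disjoint (j.erase v) (j'.erase v) := disjoint_left.2 fun x hx hx' => by
      obtain ⟨hxv, hxj⟩ := mem_erase.1 hx
      exact hL₁₂ (h.linear L₁ hL₁ L₂ hL₂ x v (hjL hxj) (hjL hvj)
        (hjL' (mem_of_mem_erase hx')) (hjL' hvj') hxv)
    refine htri (insert w (insert v (j.erase v ∪ j'.erase v))) (mem_filter.2
      ⟨mem_biUnion.2 ⟨v, hQV (hjQ hvj), mem_biUnion.2 ⟨(j.erase v, j'.erase v), mem_product.2
        ⟨mem_petals.2 ⟨L₁, hL₁, hjL hvj, erase_subset_erase _ hjL, ?_⟩,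
        mem_petals.2 ⟨L₂, hL₂, hjL' hvj', erase_subset_erase _ hjL', ?_⟩⟩,
        mem_biUnion.2 ⟨(u, u'), mem_filter.2 ⟨mem_product.2 ⟨mem_erase.2 ⟨huv, huj⟩,
          mem_erase.2 ⟨huv', huj'⟩⟩, huu⟩, mem_image.2 ⟨w, mem_biUnion.2 ⟨L, mem_filter.2
          ⟨hL, heL hu, heL hu'⟩, heL hwe⟩, rfl⟩⟩⟩⟩, ?_⟩) ?_
    · rw [card_erase_of_mem hvj, hc₁]; rfl
    · rw [card_erase_of_mem hvj', hc₂]; rfl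
    · rw [card_insert_of_notMem, card_insert_of_notMem, card_union_of_disjoint hdisj,
        card_erase_of_mem hvj, card_erase_of_mem hvj', hc₁, hc₂]
      · omega
      · simp
      · simp only [mem_insert, mem_union, mem_erase, not_or, not_and]
        exact ⟨fun hh => hwj (hh ▸ hvj), fun _ => hwj, fun _ => hwj'⟩
    · exact insert_subset (heQ hwe) (insert_subset (hjQ hvj) (union_subset
        ((erase_subset _ _).trans hjQ) ((erase_subset _ _).trans hjQ')))

/-- All members of a family of nonempty subsets of `R` can be destroyed by deleting at most as many
points as there are members. -/
theorem exists_deletion (F : Finset (Finset α)) (hF : ∀ T ∈ F, T.Nonempty) (R : Finset α) :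
    ∃ Q ⊆ R, (#R : ℝ) - #(F.filter fun T => T ⊆ R) ≤ #Q ∧ ∀ T ∈ F, ¬ T ⊆ Q := by
  rcases isEmpty_or_nonempty α with hα | hα
  · exact ⟨R, Subset.rfl, sub_le_self _ (Nat.cast_nonneg _),
      fun T hT => isEmptyElim (hF T hT).choose⟩
  choose! g hg using hF
  refine ⟨R \ (F.filter fun T => T ⊆ R).image g, sdiff_subset, ?_, fun T hT hTQ => ?_⟩
  · have h1 := le_card_sdiff ((F.filter fun T => T ⊆ R).image g) R
    have h2 : #((F.filter fun T => T ⊆ R).image g) ≤ #(F.filter fun T => T ⊆ R) := card_image_le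
    have h3 : #R ≤ #(R \ (F.filter fun T => T ⊆ R).image g) + #(F.filter fun T => T ⊆ R) := by
      omega
    have h4 : (#R : ℝ) ≤ #(R \ (F.filter fun T => T ⊆ R).image g) +
      #(F.filter fun T => T ⊆ R) := by exact_mod_cast h3
    linarith
  · exact (mem_sdiff.1 (hTQ (hg T hT))).2 (mem_image.2
      ⟨T, mem_filter.2 ⟨hT, hTQ.trans sdiff_subset⟩, rfl⟩)

/-- A random sample with density `p` contains a sparse hypergraph of large potential. -/
theorem exists_sparseHypergraph (h : PartialLinearSpace V M tr) (hk : 2 ≤ k)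
    (hℓ : ∀ L ∈ M, #(tr L) ≤ ℓ) (hΔ : ∀ x ∈ V, ∑ L ∈ M with x ∈ tr L, #(tr L) ^ k ≤ Δ)
    {p lam z : ℝ} (hp0 : 0 ≤ p) (hp1 : p ≤ 1) (hlam : 0 ≤ lam) (hz : 0 ≤ z)
    (h1 : lam * (k + 1) * z ^ k * p ^ k * Δ ≤ 1 / 4) (h2 : p ^ (k + 1) * Δ * ℓ ≤ 1 / 8)
    (h3 : p ^ (2 * k + 1) * Δ ^ 2 * k ^ 2 * ℓ ≤ 1 / 8) :
    ∃ Q ⊆ V, SparseHypergraph k Q ((collinearSets M tr (k + 1)).filter fun T => T ⊆ Q) id ∧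
      p * #V / 2 ≤
        potential lam z Q ((collinearSets M tr (k + 1)).filter fun T => T ⊆ Q) id := by
  set μ := lam * ((k + 1) * z ^ k) with hμ
  have hμ0 : 0 ≤ μ := by positivity
  have hsub : ∀ r, ∀ T ∈ collinearSets M tr r, T ⊆ V := fun r T hT => by
    obtain ⟨L, hL, hTL, -⟩ := mem_collinearSets.1 hT
    exact hTL.trans (h.subset L hL)
  have hsub3 : ∀ T ∈ triangleSets V M tr k, T ⊆ V := fun T hT => by
    obtain ⟨hT, -⟩ := mem_filter.1 hT
    simp only [mem_biUnion, mem_image, mem_product, mem_filter, mem_petals, lineThrough] at hT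
    obtain ⟨u, hu, a, ⟨⟨L, hL, -, ha, -⟩, L', hL', -, ha', -⟩, x, -, w, ⟨L'', ⟨hL'', -⟩, hw⟩, rfl⟩ :=
      hT
    exact insert_subset (h.subset _ hL'' hw) (insert_subset hu (union_subset
      ((ha.trans (erase_subset _ _)).trans (h.subset _ hL))
      ((ha'.trans (erase_subset _ _)).trans (h.subset _ hL'))))
  obtain ⟨R, hR, hle⟩ := exists_samplingMean_le (V := V) hp0 hp1 fun S =>
    (((#S : ℝ) - μ * (#((collinearSets M tr (k + 1)).filter fun T => T ⊆ S) : ℝ)) -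
      (#((collinearSets M tr (k + 2)).filter fun T => T ⊆ S) : ℝ)) -
      (#((triangleSets V M tr k).filter fun T => T ⊆ S) : ℝ)
  rw [samplingMean_sub, samplingMean_sub, samplingMean_sub, samplingMean_const_mul,
    samplingMean_card, samplingMean_card_filter (A := fun T => T) (hsub _),
    samplingMean_card_filter (A := fun T => T) (hsub _),
    samplingMean_card_filter (A := fun T => T) hsub3] at hle
  have hn : (0 : ℝ) ≤ p * #V := by positivity
  have hm1 : μ * ∑ T ∈ collinearSets M tr (k + 1), p ^ #T ≤ p * #V * (1 / 4) := by
    rw [sum_congr rfl fun T hT => by rw [(mem_collinearSets.1 hT).choose_spec.2.2], sum_const,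
      nsmul_eq_mul]
    have hc : (#(collinearSets M tr (k + 1)) : ℝ) ≤ #V * Δ := by
      exact_mod_cast h.card_collinearSets_le hΔ
    calc μ * (#(collinearSets M tr (k + 1)) * p ^ (k + 1)) ≤ μ * (#V * Δ * p ^ (k + 1)) := by gcongr
      _ = p * #V * (lam * (k + 1) * z ^ k * p ^ k * Δ) := by rw [hμ]; ring
      _ ≤ _ := mul_le_mul_of_nonneg_left h1 hn
  have hm2 : ∑ T ∈ collinearSets M tr (k + 2), p ^ #T ≤ p * #V * (1 / 8) := by
    rw [sum_congr rfl fun T hT => by rw [(mem_collinearSets.1 hT).choose_spec.2.2], sum_const,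
      nsmul_eq_mul]
    have hc : (#(collinearSets M tr (k + 2)) : ℝ) ≤ #V * Δ * ℓ := by
      exact_mod_cast h.card_collinearSets_succ_le hℓ hΔ
    calc #(collinearSets M tr (k + 2)) * p ^ (k + 2) ≤ #V * Δ * ℓ * p ^ (k + 2) := by gcongr
      _ = p * #V * (p ^ (k + 1) * Δ * ℓ) := by ring
      _ ≤ _ := mul_le_mul_of_nonneg_left h2 hn
  have hm3 : ∑ T ∈ triangleSets V M tr k, p ^ #T ≤ p * #V * (1 / 8) := by
    rw [sum_congr rfl fun T hT => by rw [(mem_filter.1 hT).2], sum_const, nsmul_eq_mul]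
    have hc : (#(triangleSets V M tr k) : ℝ) ≤ #V * (Δ * Δ * (k * k * ℓ)) := by
      exact_mod_cast h.card_triangleSets_le hℓ hΔ
    calc #(triangleSets V M tr k) * p ^ (2 * k + 2) ≤
          #V * (Δ * Δ * (k * k * ℓ)) * p ^ (2 * k + 2) := by gcongr
      _ = p * #V * (p ^ (2 * k + 1) * Δ ^ 2 * k ^ 2 * ℓ) := by ring
      _ ≤ _ := mul_le_mul_of_nonneg_left h3 hn
  obtain ⟨Q, hQR, hQ, hdel⟩ := exists_deletion
    (collinearSets M tr (k + 2) ∪ triangleSets V M tr k) (fun T hT => by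
      rw [← card_pos]
      rcases mem_union.1 hT with hT | hT
      · obtain ⟨-, -, -, hc⟩ := mem_collinearSets.1 hT
        omega
      · have := (mem_filter.1 hT).2
        omega) R
  refine ⟨Q, hQR.trans hR, h.sparseHypergraph hk (hQR.trans hR)
    (fun T hT => hdel T (mem_union_left _ hT)) (fun T hT => hdel T (mem_union_right _ hT)), ?_⟩
  have hunion : (#((collinearSets M tr (k + 2) ∪ triangleSets V M tr k).filter fun T => T ⊆ R) : ℝ)
      ≤ #((collinearSets M tr (k + 2)).filter fun T => T ⊆ R) +
        #((triangleSets V M tr k).filter fun T => T ⊆ R) := by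
    rw [filter_union]
    exact_mod_cast card_union_le _ _
  have hmono : (#((collinearSets M tr (k + 1)).filter fun T => T ⊆ Q) : ℝ) ≤
      #((collinearSets M tr (k + 1)).filter fun T => T ⊆ R) := by
    exact_mod_cast card_le_card (monotone_filter_right _ fun T (_ : T ∈ _) (hT : T ⊆ Q) => hT.trans hQR)
  have hpot : potential lam z Q ((collinearSets M tr (k + 1)).filter fun T => T ⊆ Q) id =
      #Q - μ * #((collinearSets M tr (k + 1)).filter fun T => T ⊆ Q) := by
    have hw : ∀ T ∈ (collinearSets M tr (k + 1)).filter fun T => T ⊆ Q,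
        edgeWeight id z T = (k + 1) * z ^ k := fun T hT => by
      obtain ⟨-, -, -, hc⟩ := mem_collinearSets.1 (mem_filter.1 hT).1
      simp [edgeWeight, hc]
    rw [potential, sum_congr rfl hw, sum_const, nsmul_eq_mul, hμ]
    ring
  have hμmono := mul_le_mul_of_nonneg_left hmono hμ0
  rw [hpot]
  linarith

/-- A partial linear space of bounded degree contains a large set with at most `k` points on each
line. -/
theorem exists_subset_card_le (h : PartialLinearSpace V M tr) (hk : 2 ≤ k)
    (hℓ : ∀ L ∈ M, #(tr L) ≤ ℓ) (hΔ : ∀ x ∈ V, ∑ L ∈ M with x ∈ tr L, #(tr L) ^ k ≤ Δ)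
    {p lam z K B : ℝ} (hp0 : 0 ≤ p) (hp1 : p ≤ 1) (hlam : 0 < lam) (hz : 0 < z)
    (h1 : lam * (k + 1) * z ^ k * p ^ k * Δ ≤ 1 / 4) (h2 : p ^ (k + 1) * Δ * ℓ ≤ 1 / 8)
    (h3 : p ^ (2 * k + 1) * Δ ^ 2 * k ^ 2 * ℓ ≤ 1 / 8) (hK : 2 * lam * K = 1) (hK2 : 2 ≤ K)
    (hB : (k + 1) * (K + 1) ^ 2 ≤ B) (m : ℕ) (hzm : z * (1 + K / B) ^ m ≤ 1)
    (hm : B + 4 * m ≤ z * (p * #V / 2)) :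
    ∃ S ⊆ V, m ≤ #S ∧ ∀ L ∈ M, ∀ T ⊆ S, T ⊆ tr L → #T ≤ k := by
  obtain ⟨Q, hQV, hQ, hpot⟩ := h.exists_sparseHypergraph hk hℓ hΔ hp0 hp1 hlam.le hz.le h1 h2 h3
  obtain ⟨S, hSQ, hmS, hS⟩ := hQ.exists_independent hlam hK hK2 hB m hz hzm
    (hm.trans (mul_le_mul_of_nonneg_left hpot hz.le))
  refine ⟨S, hSQ.trans hQV, hmS, fun L hL T hTS hTL => ?_⟩
  by_contra! hc
  obtain ⟨T', hT', hcard⟩ := exists_subset_card_eq (show k + 1 ≤ #T from hc)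
  exact hS T' (mem_filter.2 ⟨mem_collinearSets.2 ⟨L, hL, hT'.trans hTL, hcard⟩,
    (hT'.trans hTS).trans hSQ⟩) (hT'.trans hTS)

end PartialLinearSpace

end PartialLinearSpace

section LargeSubset

open Finset
open scoped Classical

variable {α ι : Type*} {V P : Finset α} {M : Finset ι} {tr : ι → Finset α} {k ℓ Δ : ℕ}

namespace PartialLinearSpace

theorem restrict (h : PartialLinearSpace P M tr) (V : Finset α) :
    PartialLinearSpace V M fun L => tr L ∩ V :=
  ⟨fun _ _ => inter_subset_right, fun L hL L' hL' x y hx hy hx' hy' hxy =>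
    h.linear L hL L' hL' x y (mem_inter.1 hx).1 (mem_inter.1 hy).1 (mem_inter.1 hx').1
      (mem_inter.1 hy').1 hxy⟩

/-- At least half of the points have degree at most twice the average degree. -/
theorem card_le_two_mul_card_filter (h : PartialLinearSpace P M tr)
    (hW : 2 * ∑ L ∈ M, #(tr L) ^ (k + 1) ≤ Δ * #P) :
    #P ≤ 2 * #(P.filter fun x => ∑ L ∈ M with x ∈ tr L, #(tr L) ^ k ≤ Δ) := by
  set good := P.filter fun x => ∑ L ∈ M with x ∈ tr L, #(tr L) ^ k ≤ Δ
  have hsum : ∑ L ∈ M, #(tr L) ^ (k + 1) = ∑ x ∈ P, ∑ L ∈ M with x ∈ tr L, #(tr L) ^ k := by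
    simp only [sum_filter]
    rw [sum_comm]
    refine sum_congr rfl fun L hL => ?_
    rw [← sum_filter, sum_const, smul_eq_mul, filter_mem_eq_inter,
      inter_eq_right.2 (h.subset L hL), pow_succ, mul_comm]
  have h1 : #(P \ good) * (Δ + 1) ≤ ∑ L ∈ M, #(tr L) ^ (k + 1) := by
    rw [hsum, ← smul_eq_mul]
    exact (card_nsmul_le_sum _ _ _ fun x hx => not_le.1 fun hle =>
      (mem_sdiff.1 hx).2 (mem_filter.2 ⟨(mem_sdiff.1 hx).1, hle⟩)).trans
      (sum_le_sum_of_subset sdiff_subset)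
  have h2 : 2 * #(P \ good) ≤ #P := by
    refine le_of_mul_le_mul_right ?_ (Nat.succ_pos Δ)
    rw [Nat.succ_eq_add_one]
    nlinarith
  have h3 : #(P \ good) + #good = #P := card_sdiff_add_card_eq_card (filter_subset _ _)
  omega

theorem exists_subset_card_le_of_sum_le (h : PartialLinearSpace P M tr) (hk : 2 ≤ k)
    (hℓ : ∀ L ∈ M, #(tr L) ≤ ℓ) (hW : 2 * ∑ L ∈ M, #(tr L) ^ (k + 1) ≤ Δ * #P)
    {p lam z K B : ℝ} (hp0 : 0 ≤ p) (hp1 : p ≤ 1) (hlam : 0 < lam) (hz : 0 < z)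
    (h1 : lam * (k + 1) * z ^ k * p ^ k * Δ ≤ 1 / 4) (h2 : p ^ (k + 1) * Δ * ℓ ≤ 1 / 8)
    (h3 : p ^ (2 * k + 1) * Δ ^ 2 * k ^ 2 * ℓ ≤ 1 / 8) (hK : 2 * lam * K = 1) (hK2 : 2 ≤ K)
    (hB : (k + 1) * (K + 1) ^ 2 ≤ B) (m : ℕ) (hzm : z * (1 + K / B) ^ m ≤ 1)
    (hm : B + 4 * m ≤ z * p * #P / 4) :
    ∃ S ⊆ P, m ≤ #S ∧ ∀ L ∈ M, ∀ T ⊆ S, T ⊆ tr L → #T ≤ k := by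
  set V := P.filter fun x => ∑ L ∈ M with x ∈ tr L, #(tr L) ^ k ≤ Δ with hV
  have hcard : (#P : ℝ) ≤ 2 * #V := by exact_mod_cast h.card_le_two_mul_card_filter hW
  obtain ⟨S, hSV, hmS, hS⟩ := (h.restrict V).exists_subset_card_le (Δ := Δ) hk
    (fun L hL => (card_le_card inter_subset_left).trans (hℓ L hL))
    (fun x hx => (sum_le_sum_of_subset_of_nonneg
      (monotone_filter_right _ fun L (_ : L ∈ _) (hxL : x ∈ tr L ∩ V) => (mem_inter.1 hxL).1)
      (fun _ _ _ => Nat.zero_le _)).trans ((sum_le_sum fun L _ =>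
      Nat.pow_le_pow_left (card_le_card inter_subset_left) k).trans (mem_filter.1 hx).2))
    hp0 hp1 hlam hz h1 h2 h3 hK hK2 hB m hzm (hm.trans (by
      have := mul_le_mul_of_nonneg_left hcard (mul_nonneg hz.le hp0)
      linarith))
  exact ⟨S, hSV.trans (filter_subset _ _), hmS, fun L hL T hTS hTL =>
    hS L hL T hTS (subset_inter hTL (hTS.trans hSV))⟩

theorem exists_subset_of_bounds (h : PartialLinearSpace P M tr) (hk : 3 ≤ k)
    (hℓ : ∀ L ∈ M, #(tr L) ≤ ℓ) (hW : 2 * ∑ L ∈ M, #(tr L) ^ (k + 1) ≤ Δ * #P)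
    {N C γ β t : ℝ} (hN : N = #P) (hN1 : 1 ≤ N) (hC : 1 ≤ C) (hγ : 0 < γ) (hβ0 : 0 < β)
    (hβ : β * ((k + 1) * C) = γ) (ht : 0 < t) (hΔ : (Δ : ℝ) ≤ C * t ^ k) (hNt : N ^ γ ≤ t)
    (hℓt : C ^ 2 * k ^ 2 * (N ^ γ) ^ (2 * k + 1) * ℓ ≤ t / 8)
    (hlog : β * Real.log N ≤ N ^ (γ / 2)) (hlog1 : 1 ≤ γ * Real.log N)
    (hlog2 : 1 ≤ β * Real.log N)
    (hB : (k + 1) * (2 * γ * Real.log N + 1) ^ 2 ≤ N / t / 8) :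
    ∃ S ⊆ P, (β * Real.log N) ^ (1 / (k : ℝ)) * (N / t) / 64 ≤ #S ∧
      ∀ L ∈ M, ∀ T ⊆ S, T ⊆ tr L → #T ≤ k := by
  have hN0 : 0 < N := by linarith
  have hk0 : (0 : ℝ) < k := by exact_mod_cast (by omega : 0 < k)
  have hk1 : (1 : ℝ) ≤ k := by exact_mod_cast (by omega : 1 ≤ k)
  have hlog0 : 0 < Real.log N := by
    by_contra! hneg
    nlinarith
  set g := N ^ γ with hg
  have hg1 : 1 ≤ g := Real.one_le_rpow hN1 hγ.le
  have hg0 : 0 < g := by linarith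
  set x := (β * Real.log N) ^ (1 / (k : ℝ)) with hx
  have hx1 : 1 ≤ x := Real.one_le_rpow hlog2 (by positivity)
  have hx0 : 0 < x := by linarith
  have hxk : x ^ k = β * Real.log N := by
    rw [hx, one_div]
    exact Real.rpow_inv_natCast_pow (by linarith) (by omega)
  have hxN : x ≤ N ^ (γ / 2) := by
    refine le_trans ?_ hlog
    rw [← hxk]
    exact le_self_pow₀ hx1 (by omega)
  set B := x * (N / t) / 8 with hBdef
  have hBx : N / t / 8 ≤ B := by
    have : 0 < N / t := by positivity
    rw [hBdef]
    nlinarith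
  have hB0 : 0 < B := by positivity
  set K := 2 * γ * Real.log N with hK
  set m := ⌊B / 4⌋₊ with hm
  have hmB : (m : ℝ) ≤ B / 4 := Nat.floor_le (by positivity)
  have hp1 : g / t ≤ 1 := (div_le_one ht).2 hNt
  have hpow : ∀ j, (g / t) ^ (j + 1) * t ^ j = g ^ (j + 1) / t := fun j => by
    rw [div_pow]
    field_simp
    ring
  have hk2 : (1 : ℝ) ≤ (k : ℝ) ^ 2 := one_le_pow₀ hk1
  obtain ⟨S, hSP, hmS, hS⟩ := h.exists_subset_card_le_of_sum_le (p := g / t) (z := x / g)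
    (lam := 1 / (4 * γ * Real.log N)) (K := K) (B := B) (by omega) hℓ hW (by positivity) hp1
    (by positivity) (by positivity) (by
      calc 1 / (4 * γ * Real.log N) * (k + 1) * (x / g) ^ k * (g / t) ^ k * Δ
          ≤ 1 / (4 * γ * Real.log N) * (k + 1) * (x / g) ^ k * (g / t) ^ k * (C * t ^ k) := by
            gcongr
        _ = 1 / (4 * γ * Real.log N) * (k + 1) * C * x ^ k := by
            rw [div_pow, div_pow]
            field_simp
        _ = 1 / (4 * γ * Real.log N) * ((β * ((k + 1) * C)) * Real.log N) := by rw [hxk]; ring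
        _ = 1 / 4 := by
            rw [hβ]
            field_simp
        _ ≤ 1 / 4 := le_rfl) (by
      calc (g / t) ^ (k + 1) * Δ * ℓ ≤ (g / t) ^ (k + 1) * (C * t ^ k) * ℓ := by gcongr
        _ = (C * g ^ (k + 1) * ℓ) / t := by
            rw [mul_comm C, ← mul_assoc, hpow]; ring
        _ ≤ (C ^ 2 * k ^ 2 * g ^ (2 * k + 1) * ℓ) / t := by
            have e1 : C ≤ C ^ 2 * k ^ 2 := by nlinarith
            have e2 : g ^ (k + 1) ≤ g ^ (2 * k + 1) := pow_le_pow_right₀ hg1 (by omega)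
            gcongr
        _ ≤ t / 8 / t := by gcongr
        _ = 1 / 8 := by field_simp) (by
      calc (g / t) ^ (2 * k + 1) * Δ ^ 2 * k ^ 2 * ℓ
          ≤ (g / t) ^ (2 * k + 1) * (C * t ^ k) ^ 2 * k ^ 2 * ℓ := by gcongr
        _ = ((g / t) ^ (2 * k + 1) * t ^ (2 * k)) * (C ^ 2 * k ^ 2 * ℓ) := by ring
        _ = (C ^ 2 * k ^ 2 * g ^ (2 * k + 1) * ℓ) / t := by rw [hpow]; ring
        _ ≤ t / 8 / t := by gcongr
        _ = 1 / 8 := by field_simp) (by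
      rw [hK]
      field_simp
      norm_num) (by rw [hK]; linarith) (hB.trans hBx) m (by
      have e1 : (1 + K / B) ^ m ≤ Real.exp (K / 4) := by
        calc (1 + K / B) ^ m ≤ Real.exp (K / B) ^ m := by
              gcongr
              linarith [Real.add_one_le_exp (K / B)]
          _ = Real.exp (K / B * m) := by rw [← Real.exp_nat_mul, mul_comm]
          _ ≤ Real.exp (K / 4) := by
              gcongr
              calc K / B * m ≤ K / B * (B / 4) := by gcongr
                _ = K / 4 := by field_simp
      have e2 : Real.exp (K / 4) = N ^ (γ / 2) := by
        rw [Real.rpow_def_of_pos hN0, hK]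
        ring_nf
      have e3 : g = N ^ (γ / 2) * N ^ (γ / 2) := by
        rw [hg, ← Real.rpow_add hN0, add_halves]
      have e4 : 0 < N ^ (γ / 2) := by positivity
      calc x / g * (1 + K / B) ^ m ≤ N ^ (γ / 2) / g * N ^ (γ / 2) := by
            rw [e2] at e1
            gcongr
        _ = 1 := by rw [e3]; field_simp) (by
      have e1 : x / g * (g / t) * #P / 4 = 2 * B := by
        rw [hBdef, ← hN]
        field_simp
        norm_num
      rw [e1]
      linarith)
  refine ⟨S, hSP, ?_, hS⟩
  have hm' : B / 4 < m + 1 := Nat.lt_floor_add_one _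
  have hmS' : (m : ℝ) ≤ #S := by exact_mod_cast hmS
  have hB9 : 9 ≤ B := by
    refine le_trans ?_ (hB.trans hBx)
    nlinarith [sq_nonneg (K - 2)]
  have : x * (N / t) / 64 = B / 8 := by rw [hBdef]; ring
  rw [this]
  linarith

end PartialLinearSpace

end LargeSubset

section Plane

open Finset Filter Asymptotics
open scoped Classical

theorem eventually_parameter_bounds {γ β a : ℝ} (A A' : ℝ) (hγ : 0 < γ) (hβ : 0 < β)
    (ha : 0 < a) : ∀ᶠ x : ℝ in atTop, A * x ^ (-a) ≤ 1 / 8 ∧ β * Real.log x ≤ x ^ (γ / 2) ∧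
      1 ≤ γ * Real.log x ∧ 1 ≤ β * Real.log x ∧
      A' * (2 * γ * Real.log x + 1) ^ 2 ≤ x ^ (1 / 2 : ℝ) := by
  have h1 : ∀ᶠ x : ℝ in atTop, A * x ^ (-a) < 1 / 8 := by
    have := (tendsto_rpow_neg_atTop ha).const_mul A
    rw [mul_zero] at this
    exact this.eventually_lt_const (by norm_num)
  have h2 : ∀ᶠ x : ℝ in atTop, β * Real.log x ≤ x ^ (γ / 2) := by
    have := ((isLittleO_log_rpow_atTop (half_pos hγ)).const_mul_left β).bound one_pos
    filter_upwards [this, eventually_ge_atTop 0] with x hx hx0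
    rw [one_mul, Real.norm_of_nonneg (Real.rpow_nonneg hx0 _)] at hx
    exact (le_abs_self _).trans hx
  have h3 : ∀ᶠ x : ℝ in atTop, 1 ≤ γ * Real.log x :=
    (Real.tendsto_log_atTop.const_mul_atTop hγ).eventually_ge_atTop 1
  have h4 : ∀ᶠ x : ℝ in atTop, 1 ≤ β * Real.log x :=
    (Real.tendsto_log_atTop.const_mul_atTop hβ).eventually_ge_atTop 1
  have h5 : ∀ᶠ x : ℝ in atTop, A' * (2 * γ * Real.log x + 1) ^ 2 ≤ x ^ (1 / 2 : ℝ) := by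
    have hq : (0 : ℝ) < 1 / 4 := by norm_num
    have e1 : (fun x : ℝ => 2 * γ * Real.log x + 1) =o[atTop] fun x : ℝ => x ^ (1 / 4 : ℝ) :=
      ((isLittleO_log_rpow_atTop hq).const_mul_left _).add
        (isLittleO_const_left.2 (Or.inr (tendsto_norm_atTop_atTop.comp (tendsto_rpow_atTop hq))))
    have e2 := ((e1.pow two_pos).const_mul_left A').bound one_pos
    filter_upwards [e2, eventually_ge_atTop 0] with x hx hx0
    have e3 : (x ^ (1 / 4 : ℝ)) ^ 2 = x ^ (1 / 2 : ℝ) := by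
      rw [← Real.rpow_natCast, ← Real.rpow_mul hx0]
      norm_num
    rw [one_mul, e3, Real.norm_of_nonneg (Real.rpow_nonneg hx0 _)] at hx
    exact (le_abs_self _).trans hx
  filter_upwards [h1, h2, h3, h4, h5] with x h1 h2 h3 h4 h5 using ⟨h1.le, h2, h3, h4, h5⟩

theorem collinear_lineTrace (P : Finset (ℝ × ℝ)) (L : ℝ × ℝ) :
    Collinear ℝ (lineTrace P L : Set (ℝ × ℝ)) := by
  rw [collinear_iff_exists_forall_eq_smul_vadd]
  refine ⟨(0, L.2), (1, L.1), fun w hw => ⟨w.1, Prod.ext (by simp) ?_⟩⟩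
  have := (mem_lineTrace.1 (mem_coe.1 hw)).2
  simp only [vadd_eq_add, Prod.snd_add, Prod.smul_snd, smul_eq_mul]
  linarith

theorem exists_subset_lineTrace {P T : Finset (ℝ × ℝ)}
    (hP : Set.InjOn Prod.fst (P : Set (ℝ × ℝ))) (hTP : T ⊆ P) (hT : Collinear ℝ (T : Set (ℝ × ℝ)))
    (hcard : 1 < #T) : ∃ L ∈ spannedLines P, T ⊆ lineTrace P L := by
  obtain ⟨u, hu, v, hv, huv⟩ := one_lt_card.1 hcard
  have hne : u.1 ≠ v.1 := fun h => huv (hP (hTP hu) (hTP hv) h)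
  wlog hlt : u.1 < v.1 generalizing u v
  · exact this v hv u hu huv.symm hne.symm (lt_of_le_of_ne (not_lt.1 hlt) hne.symm)
  obtain ⟨L, hL, huL, hvL⟩ := exists_mem_spannedLines (hTP hu) (hTP hv) hlt
  refine ⟨L, hL, fun w hw => mem_lineTrace.2 ⟨hTP hw, ?_⟩⟩
  obtain ⟨p, q, hpq⟩ := (collinear_iff_exists_forall_eq_smul_vadd _).1 hT
  obtain ⟨r, hr⟩ := hpq u (mem_coe.2 hu)
  obtain ⟨s, hs⟩ := hpq v (mem_coe.2 hv)
  obtain ⟨t, ht⟩ := hpq w (mem_coe.2 hw)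
  have hu2 := (mem_lineTrace.1 huL).2
  have hv2 := (mem_lineTrace.1 hvL).2
  rw [hr, hs] at hlt
  rw [hr] at hu2
  rw [hs] at hv2
  rw [ht]
  simp only [vadd_eq_add, Prod.fst_add, Prod.snd_add, Prod.smul_fst, Prod.smul_snd,
    smul_eq_mul] at hlt hu2 hv2 ⊢
  have hrs : s - r ≠ 0 := fun h => by
    rw [sub_eq_zero.1 h] at hlt
    exact lt_irrefl _ hlt
  have hq : q.2 = L.1 * q.1 := by
    refine mul_left_cancel₀ hrs ?_
    linarith
  rw [hq] at hu2 ⊢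
  linarith

theorem partialLinearSpace_spannedLines {P : Finset (ℝ × ℝ)}
    (hP : Set.InjOn Prod.fst (P : Set (ℝ × ℝ))) :
    PartialLinearSpace P (spannedLines P) (lineTrace P) :=
  ⟨fun _ _ => filter_subset _ _, fun _ _ _ _ _ _ hx hy hx' hy' hxy =>
    eq_of_two_common_points hP hx hy hx' hy' hxy⟩

end Plane

section Scale

variable {k : ℕ} {N ℓ D ε : ℝ}

theorem rpow_inv_scale_pow (hk : 3 ≤ k) (hN : 1 ≤ N) (hℓ : 1 ≤ ℓ) :
    ((N * ℓ ^ (k - 2)) ^ (1 / (k : ℝ))) ^ k = N * ℓ ^ (k - 2) := by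
  rw [one_div]
  exact Real.rpow_inv_natCast_pow (by positivity) (by omega)

theorem rpow_le_scale (hN : 1 ≤ N) (hℓ : 1 ≤ ℓ) :
    N ^ (1 / (k : ℝ)) ≤ (N * ℓ ^ (k - 2)) ^ (1 / (k : ℝ)) :=
  Real.rpow_le_rpow (by positivity)
    (le_mul_of_one_le_right (by positivity) (one_le_pow₀ hℓ)) (by positivity)

theorem scale_le_sqrt (hk : 3 ≤ k) (hN : 1 ≤ N) (hℓ : 1 ≤ ℓ) (hD : 1 ≤ D) (hε : 0 < ε)
    (h : ℓ ≤ D * N ^ ((1 - ε) / 2)) :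
    (N * ℓ ^ (k - 2)) ^ (1 / (k : ℝ)) ≤ D * N ^ (1 / 2 : ℝ) := by
  have hN0 : 0 ≤ N := by linarith
  have h1 : ℓ ≤ D * N ^ (1 / 2 : ℝ) := h.trans <|
    mul_le_mul_of_nonneg_left (Real.rpow_le_rpow_of_exponent_le hN (by linarith)) (by linarith)
  refine le_of_pow_le_pow_left₀ (by omega : k ≠ 0) (by positivity) ?_
  rw [rpow_inv_scale_pow hk hN hℓ]
  have h2 : N ≤ (D * N ^ (1 / 2 : ℝ)) ^ 2 := by
    rw [mul_pow, ← Real.rpow_natCast (N ^ (1 / 2 : ℝ)), ← Real.rpow_mul hN0]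
    norm_num
    exact le_mul_of_one_le_left hN0 (one_le_pow₀ hD)
  calc N * ℓ ^ (k - 2) ≤ (D * N ^ (1 / 2 : ℝ)) ^ 2 * (D * N ^ (1 / 2 : ℝ)) ^ (k - 2) := by gcongr
    _ = _ := by rw [← pow_add]; congr 1; omega

theorem le_rpow_mul_scale (hk : 3 ≤ k) (hN : 1 ≤ N) (hℓ : 1 ≤ ℓ) (hD : 1 ≤ D)
    (h : ℓ ≤ D * N ^ ((1 - ε) / 2)) :
    ℓ ≤ D * N ^ (-(ε / k)) * (N * ℓ ^ (k - 2)) ^ (1 / (k : ℝ)) := by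
  have hN0 : 0 < N := by linarith
  have hk0 : (k : ℝ) ≠ 0 := by positivity
  refine le_of_pow_le_pow_left₀ (by omega : k ≠ 0) (by positivity) ?_
  rw [mul_pow, rpow_inv_scale_pow hk hN hℓ, mul_pow, ← Real.rpow_natCast (N ^ (-(ε / k))),
    ← Real.rpow_mul hN0.le]
  have e1 : -(ε / k) * (k : ℝ) = -ε := by field_simp
  have e2 : (N ^ ((1 - ε) / 2)) ^ 2 = N ^ (-ε) * N := by
    rw [← Real.rpow_natCast, ← Real.rpow_mul hN0.le]
    nth_rewrite 3 [← Real.rpow_one N]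
    rw [← Real.rpow_add hN0]
    congr 1
    push_cast
    ring
  rw [e1]
  calc ℓ ^ k = ℓ ^ 2 * ℓ ^ (k - 2) := by rw [← pow_add]; congr 1; omega
    _ ≤ (D * N ^ ((1 - ε) / 2)) ^ 2 * ℓ ^ (k - 2) := by gcongr
    _ = D ^ 2 * (N ^ (-ε) * N) * ℓ ^ (k - 2) := by rw [mul_pow, e2]
    _ ≤ D ^ k * (N ^ (-ε) * N) * ℓ ^ (k - 2) := by
        gcongr
        omega
    _ = _ := by ring

theorem div_scale (hk : 3 ≤ k) (hN : 1 ≤ N) (hℓ : 1 ≤ ℓ) :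
    N / (N * ℓ ^ (k - 2)) ^ (1 / (k : ℝ)) =
      N ^ (((k : ℝ) - 1) / k) / ℓ ^ (((k : ℝ) - 2) / k) := by
  have hN0 : 0 < N := by linarith
  have hℓ0 : 0 < ℓ := by linarith
  have hk0 : (k : ℝ) ≠ 0 := by positivity
  rw [Real.mul_rpow hN0.le (by positivity), ← Real.rpow_natCast ℓ, ← Real.rpow_mul hℓ0.le,
    Nat.cast_sub (by omega : 2 ≤ k), div_mul_eq_div_div]
  congr 1
  · nth_rewrite 1 [← Real.rpow_one N]
    rw [← Real.rpow_sub hN0]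
    congr 1
    field_simp
  · congr 1
    push_cast
    ring

end Scale

section Large

open Finset Filter
open scoped Classical

theorem atMostCollinear_of_lineTrace {P S : Finset (ℝ × ℝ)} {k : ℕ}
    (hP : Set.InjOn Prod.fst (P : Set (ℝ × ℝ))) (hSP : S ⊆ P) (hk : 1 ≤ k)
    (h : ∀ L ∈ spannedLines P, ∀ T ⊆ S, T ⊆ lineTrace P L → #T ≤ k) : AtMostCollinear S k := by
  intro T hTS hT
  by_cases hcard : 1 < #T
  · obtain ⟨L, hL, hTL⟩ := exists_subset_lineTrace hP (hTS.trans hSP) hT hcard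
    exact h L hL T hTS hTL
  · omega

theorem exists_large_atMostCollinear {k : ℕ} (hk : 3 ≤ k) {d ε : ℝ} (hε : 0 < ε) :
    ∃ c > 0, ∀ᶠ N : ℝ in atTop, ∀ (ℓ : ℕ) (P : Finset (ℝ × ℝ)),
      Set.InjOn Prod.fst (P : Set (ℝ × ℝ)) → 1 ≤ ℓ → (ℓ : ℝ) ≤ d * N ^ ((1 - ε) / 2) →
      N = #P → AtMostCollinear P ℓ → ∃ S ⊆ P, AtMostCollinear S k ∧
        c * (N ^ (((k : ℝ) - 1) / k) / (ℓ : ℝ) ^ (((k : ℝ) - 2) / k)) *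
          Real.log N ^ (1 / (k : ℝ)) ≤ #S := by
  have hk0 : (0 : ℝ) < k := by exact_mod_cast (by omega : 0 < k)
  have hk1 : (1 : ℝ) ≤ k := by exact_mod_cast (by omega : 1 ≤ k)
  set D := max d 1
  have hD : 1 ≤ D := le_max_right _ _
  set C₁ : ℝ := 2 * (k + 1) * (576 + 12 * D ^ 2) with hC₁
  have hC₁0 : 0 ≤ C₁ := by positivity
  set C := 2 * C₁ + 1 with hC
  have hC1 : 1 ≤ C := by linarith
  have hC0 : 0 < C := by linarith
  set γ := min ε 1 / (6 * k ^ 2) with hγ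
  have hm : 0 < min ε 1 := lt_min hε one_pos
  have hγ0 : 0 < γ := by positivity
  set β := γ / ((k + 1) * C)
  have hβ0 : 0 < β := by positivity
  have hβ : β * ((k + 1) * C) = γ := div_mul_cancel₀ _ (by positivity)
  refine ⟨β ^ (1 / (k : ℝ)) / 64, by positivity, ?_⟩
  have ha : 0 < ε / (2 * k) := by positivity
  filter_upwards [eventually_parameter_bounds (C ^ 2 * k ^ 2 * D) (8 * D * (k + 1)) hγ0 hβ0 ha,
    eventually_ge_atTop 1] with N hev hN1 ℓ P hP hℓ1 hℓd hN hPℓ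
  obtain ⟨hA, hlog, hlog1, hlog2, hB⟩ := hev
  have hN0 : 0 < N := by linarith
  have hℓ1' : (1 : ℝ) ≤ ℓ := by exact_mod_cast hℓ1
  have hℓD : (ℓ : ℝ) ≤ D * N ^ ((1 - ε) / 2) :=
    hℓd.trans (mul_le_mul_of_nonneg_right (le_max_left _ _) (by positivity))
  have htr : ∀ L ∈ spannedLines P, #(lineTrace P L) ≤ ℓ := fun L _ =>
    hPℓ _ (filter_subset _ _) (collinear_lineTrace P L)
  have hlogN : 0 ≤ Real.log N := Real.log_nonneg hN1
  have hpow := rpow_inv_scale_pow hk hN1 hℓ1'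
  have hNt := rpow_le_scale (k := k) hN1 hℓ1'
  have htN := scale_le_sqrt hk hN1 hℓ1' hD hε hℓD
  have hℓt := le_rpow_mul_scale hk hN1 hℓ1' hD hℓD
  have hdiv := div_scale hk hN1 hℓ1'
  set t := (N * (ℓ : ℝ) ^ (k - 2)) ^ (1 / (k : ℝ))
  have ht : 0 < t := by positivity
  have htk : 1 ≤ t ^ k := by
    rw [hpow]
    exact one_le_mul_of_one_le_of_one_le hN1 (one_le_pow₀ hℓ1')
  have hℓ2 : (ℓ : ℝ) ^ 2 ≤ D ^ 2 * #P := by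
    rw [← hN]
    calc (ℓ : ℝ) ^ 2 ≤ (D * N ^ (1 / 2 : ℝ)) ^ 2 := by
          gcongr
          exact hℓD.trans (mul_le_mul_of_nonneg_left
            (Real.rpow_le_rpow_of_exponent_le hN1 (by linarith)) (by linarith))
      _ = D ^ 2 * N := by
          rw [mul_pow, ← Real.rpow_natCast (N ^ (1 / 2 : ℝ)), ← Real.rpow_mul hN0.le]
          norm_num
  have hsum := sum_card_lineTrace_pow_le hP hk htr hℓ2
  have hW : 2 * ∑ L ∈ spannedLines P, #(lineTrace P L) ^ (k + 1) ≤ ⌈2 * C₁ * t ^ k⌉₊ * #P := by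
    have h1 : (2 * ∑ L ∈ spannedLines P, (#(lineTrace P L) : ℝ) ^ (k + 1)) ≤
        (⌈2 * C₁ * t ^ k⌉₊ : ℝ) * #P := by
      calc _ ≤ 2 * (C₁ * ((#P : ℝ) ^ 2 * (ℓ : ℝ) ^ (k - 2))) := by linarith
        _ = 2 * C₁ * t ^ k * #P := by rw [hpow, hN]; ring
        _ ≤ _ := mul_le_mul_of_nonneg_right (Nat.le_ceil _) (Nat.cast_nonneg _)
    exact_mod_cast h1
  have hΔ : (⌈2 * C₁ * t ^ k⌉₊ : ℝ) ≤ C * t ^ k := by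
    have := (Nat.ceil_lt_add_one (by positivity : 0 ≤ 2 * C₁ * t ^ k)).le
    rw [hC]
    linarith
  have hγk : γ ≤ 1 / k := by
    rw [hγ, div_le_div_iff₀ (by positivity) hk0]
    nlinarith [min_le_right ε 1]
  have hγε : γ * (2 * k + 1) ≤ ε / (2 * k) := by
    have : (2 * k + 1 : ℝ) ≤ 3 * k := by linarith
    calc γ * (2 * k + 1) ≤ ε / (6 * k ^ 2) * (3 * k) := by
          rw [hγ]
          gcongr
          exact min_le_left _ _
      _ = ε / (2 * k) := by
          field_simp
          norm_num
  have hNγ : (N ^ γ) ^ (2 * k + 1) ≤ N ^ (ε / (2 * k)) := by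
    rw [← Real.rpow_natCast, ← Real.rpow_mul hN0.le]
    refine Real.rpow_le_rpow_of_exponent_le hN1 ?_
    exact_mod_cast hγε
  have hℓt8 : C ^ 2 * k ^ 2 * (N ^ γ) ^ (2 * k + 1) * ℓ ≤ t / 8 := by
    calc C ^ 2 * k ^ 2 * (N ^ γ) ^ (2 * k + 1) * ℓ
        ≤ C ^ 2 * k ^ 2 * N ^ (ε / (2 * k)) * (D * N ^ (-(ε / k)) * t) := by gcongr
      _ = C ^ 2 * k ^ 2 * D * (N ^ (ε / (2 * k)) * N ^ (-(ε / k))) * t := by ring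
      _ = C ^ 2 * k ^ 2 * D * N ^ (-(ε / (2 * k))) * t := by
          rw [← Real.rpow_add hN0]
          congr 3
          field_simp
          ring
      _ ≤ 1 / 8 * t := by gcongr
      _ = t / 8 := by ring
  have hBt : (k + 1) * (2 * γ * Real.log N + 1) ^ 2 ≤ N / t / 8 := by
    rw [le_div_iff₀ (by norm_num), le_div_iff₀ ht]
    calc (k + 1) * (2 * γ * Real.log N + 1) ^ 2 * 8 * t
        ≤ (k + 1) * (2 * γ * Real.log N + 1) ^ 2 * 8 * (D * N ^ (1 / 2 : ℝ)) := by gcongr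
      _ = 8 * D * (k + 1) * (2 * γ * Real.log N + 1) ^ 2 * N ^ (1 / 2 : ℝ) := by ring
      _ ≤ N ^ (1 / 2 : ℝ) * N ^ (1 / 2 : ℝ) := by gcongr
      _ = N := by
          rw [← Real.rpow_add hN0]
          norm_num
  obtain ⟨S, hSP, hS, hSk⟩ := (partialLinearSpace_spannedLines hP).exists_subset_of_bounds hk htr
    hW hN hN1 hC1 hγ0 hβ0 hβ ht hΔ
    ((Real.rpow_le_rpow_of_exponent_le hN1 hγk).trans hNt) hℓt8 hlog hlog1 hlog2 hBt
  refine ⟨S, hSP, atMostCollinear_of_lineTrace hP hSP (by omega) hSk, le_trans (le_of_eq ?_) hS⟩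
  rw [← hdiv, Real.mul_rpow hβ0.le hlogN]
  ring

end Large

section Shear

open Finset
open scoped Classical

theorem Collinear.image_linearMap {K V W : Type*} [DivisionRing K] [AddCommGroup V] [Module K V]
    [AddCommGroup W] [Module K W] {s : Set V} (hs : Collinear K s) (f : V →ₗ[K] W) :
    Collinear K (f '' s) := by
  obtain ⟨p, v, h⟩ := (collinear_iff_exists_forall_eq_smul_vadd _).1 hs
  refine (collinear_iff_exists_forall_eq_smul_vadd _).2 ⟨f p, f v, ?_⟩
  rintro _ ⟨x, hx, rfl⟩
  obtain ⟨r, rfl⟩ := h x hx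
  exact ⟨r, by simp⟩

theorem AtMostCollinear.image {P : Finset (ℝ × ℝ)} {k : ℕ} (h : AtMostCollinear P k)
    (e : (ℝ × ℝ) ≃ₗ[ℝ] ℝ × ℝ) : AtMostCollinear (P.image e) k := by
  intro T hT hcol
  have hsub : T.image e.symm ⊆ P := by
    intro x hx
    obtain ⟨y, hy, rfl⟩ := mem_image.1 hx
    obtain ⟨z, hz, rfl⟩ := mem_image.1 (hT hy)
    simpa using hz
  have := h (T.image e.symm) hsub (by
    rw [coe_image]
    exact hcol.image_linearMap e.symm.toLinearMap)
  rwa [card_image_of_injective _ e.symm.injective] at this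

/-- The shear `(x, y) ↦ (x + a * y, y)`. -/
def shear (a : ℝ) : (ℝ × ℝ) ≃ₗ[ℝ] ℝ × ℝ where
  toFun p := (p.1 + a * p.2, p.2)
  invFun p := (p.1 - a * p.2, p.2)
  map_add' p q := Prod.ext (by simp; ring) (by simp)
  map_smul' r p := Prod.ext (by simp; ring) (by simp)
  left_inv p := by simp
  right_inv p := by simp

theorem exists_injOn_shear (P : Finset (ℝ × ℝ)) :
    ∃ a, Set.InjOn Prod.fst (P.image (shear a) : Set (ℝ × ℝ)) := by
  obtain ⟨a, ha⟩ := Infinite.exists_notMem_finset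
    ((P ×ˢ P).image fun z => -((z.1.1 - z.2.1) / (z.1.2 - z.2.2)))
  refine ⟨a, fun x hx y hy hxy => ?_⟩
  obtain ⟨u, hu, rfl⟩ := mem_image.1 (mem_coe.1 hx)
  obtain ⟨v, hv, rfl⟩ := mem_image.1 (mem_coe.1 hy)
  have hxy' : u.1 + a * u.2 = v.1 + a * v.2 := hxy
  by_cases huv : u.2 = v.2
  · rw [huv] at hxy'
    rw [Prod.ext (add_right_cancel hxy') huv]
  · refine absurd (mem_image.2 ⟨(u, v), mem_product.2 ⟨hu, hv⟩, ?_⟩) ha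
    have : u.2 - v.2 ≠ 0 := sub_ne_zero.2 huv
    field_simp
    linarith

theorem exists_atMostCollinear_of_shear {P : Finset (ℝ × ℝ)} {k ℓ : ℕ} {m : ℝ}
    (hP : AtMostCollinear P ℓ)
    (h : ∀ Q : Finset (ℝ × ℝ), Set.InjOn Prod.fst (Q : Set (ℝ × ℝ)) → #Q = #P →
      AtMostCollinear Q ℓ → ∃ S ⊆ Q, AtMostCollinear S k ∧ m ≤ #S) :
    ∃ S ⊆ P, AtMostCollinear S k ∧ m ≤ #S := by
  obtain ⟨a, ha⟩ := exists_injOn_shear P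
  obtain ⟨S, hSQ, hS, hm⟩ := h _ ha (card_image_of_injective _ (shear a).injective)
    (hP.image (shear a))
  refine ⟨S.image (shear a).symm, ?_, hS.image _, ?_⟩
  · intro x hx
    obtain ⟨y, hy, rfl⟩ := mem_image.1 hx
    obtain ⟨z, hz, rfl⟩ := mem_image.1 (hSQ hy)
    simpa using hz
  · rwa [card_image_of_injective _ (shear a).symm.injective]

theorem rpow_div_rpow_mul_log_rpow_le_sq {k n ℓ : ℕ} (hk : 3 ≤ k) (hn : 1 ≤ n) (hℓ : 1 ≤ ℓ) :
    (n : ℝ) ^ (((k : ℝ) - 1) / k) / (ℓ : ℝ) ^ (((k : ℝ) - 2) / k) * Real.log n ^ (1 / (k : ℝ)) ≤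
      (n : ℝ) ^ 2 := by
  have hk0 : (3 : ℝ) ≤ k := by exact_mod_cast hk
  have hn1 : (1 : ℝ) ≤ n := by exact_mod_cast hn
  have hℓ1 : (1 : ℝ) ≤ ℓ := by exact_mod_cast hℓ
  have h1 : (n : ℝ) ^ (((k : ℝ) - 1) / k) ≤ n := by
    refine (Real.rpow_le_rpow_of_exponent_le hn1 ?_).trans_eq (Real.rpow_one _)
    rw [div_le_one (by linarith)]
    linarith
  have h2 : 1 ≤ (ℓ : ℝ) ^ (((k : ℝ) - 2) / k) :=
    Real.one_le_rpow hℓ1 (div_nonneg (by linarith) (by linarith))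
  have h3 : Real.log n ^ (1 / (k : ℝ)) ≤ n := by
    refine (Real.rpow_le_rpow (Real.log_nonneg hn1) (Real.log_le_self (by linarith))
      (by positivity)).trans ((Real.rpow_le_rpow_of_exponent_le hn1 ?_).trans_eq (Real.rpow_one _))
    rw [div_le_one (by linarith)]
    linarith
  rw [sq]
  exact mul_le_mul ((div_le_self (by positivity) h2).trans h1) h3
    (Real.rpow_nonneg (Real.log_nonneg hn1) _) (by linarith)

theorem atMostCollinear_singleton (p : ℝ × ℝ) {k : ℕ} (hk : 1 ≤ k) : AtMostCollinear {p} k :=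
  fun _ hT _ => (card_le_card hT).trans (by simpa using hk)

end Shear

/-- For every fixed `k ≥ 3`, `d > 0` and `0 < ε < 1` there is `c > 0` such that every set
of `n` points in the plane with at most `ℓ` collinear, where `4 ≤ ℓ ≤ d·n^((1−ε)/2)` and
`k < ℓ`, contains at least `c·(n^((k−1)/k)/ℓ^((k−2)/k))·(log n)^(1/k)` points with at
most `k` collinear. -/
theorem at_most_k_collinear_subset_with_log :
    ∀ k : ℕ, 3 ≤ k →
    ∀ d ε : ℝ, 0 < d → 0 < ε → ε < 1 →
    ∃ c : ℝ, 0 < c ∧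
      ∀ (n ℓ : ℕ) (P : Finset (ℝ × ℝ)),
        4 ≤ ℓ → (ℓ : ℝ) ≤ d * (n : ℝ) ^ ((1 - ε) / 2) → k < ℓ →
        P.card = n → AtMostCollinear P ℓ →
        ∃ S ⊆ P, AtMostCollinear S k ∧
          c * ((n : ℝ) ^ (((k : ℝ) - 1) / (k : ℝ)) /
                (ℓ : ℝ) ^ (((k : ℝ) - 2) / (k : ℝ))) *
            Real.log n ^ ((1 : ℝ) / (k : ℝ)) ≤ S.card := by
  intro k hk d ε _ hε hε1
  obtain ⟨c, hc, hlarge⟩ := exists_large_atMostCollinear hk (d := d) hε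
  obtain ⟨N₀, hN₀⟩ := Filter.eventually_atTop.1 hlarge
  refine ⟨min c (1 / (max N₀ 1) ^ 2), by positivity, ?_⟩
  intro n ℓ P hℓ hℓn _ hPn hP
  have hn : 1 ≤ n := by
    rcases Nat.eq_zero_or_pos n with rfl | h
    · rw [Nat.cast_zero, Real.zero_rpow (by linarith), mul_zero] at hℓn
      have : (4 : ℝ) ≤ ℓ := by exact_mod_cast hℓ
      linarith
    · exact h
  have hX : 0 ≤ (n : ℝ) ^ (((k : ℝ) - 1) / k) / (ℓ : ℝ) ^ (((k : ℝ) - 2) / k) *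
      Real.log n ^ (1 / (k : ℝ)) :=
    mul_nonneg (by positivity) (Real.rpow_nonneg (Real.log_natCast_nonneg n) _)
  rcases le_total N₀ n with h | h
  · refine exists_atMostCollinear_of_shear hP fun Q hQ hQP hQℓ => ?_
    obtain ⟨S, hSQ, hS, hcard⟩ := hN₀ n h ℓ Q hQ (by omega) hℓn (by rw [hQP, hPn]) hQℓ
    refine ⟨S, hSQ, hS, le_trans ?_ hcard⟩
    rw [mul_assoc, mul_assoc]
    exact mul_le_mul_of_nonneg_right (min_le_left _ _) hX
  · obtain ⟨p, hp⟩ := Finset.card_pos.1 (by omega : 0 < P.card)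
    refine ⟨{p}, Finset.singleton_subset_iff.2 hp, atMostCollinear_singleton p (by omega), ?_⟩
    rw [mul_assoc, Finset.card_singleton, Nat.cast_one]
    calc _ ≤ 1 / (max N₀ 1) ^ 2 * (n : ℝ) ^ 2 :=
          mul_le_mul (min_le_right _ _)
            (rpow_div_rpow_mul_log_rpow_le_sq hk hn (by omega)) hX (by positivity)
      _ ≤ 1 / (max N₀ 1) ^ 2 * (max N₀ 1) ^ 2 := by
          gcongr
          exact h.trans (le_max_left _ _)
      _ = 1 := one_div_mul_cancel (by positivity)
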